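/- arXiv:2304.12070 — 10 statements merged into one kernel-verified Lean document; each statement's English description precedes it below -/
import Mathlib

section
/- Let I(x,y) be a symmetric positive real function with property P*, and let TI be the associated VDB topological index. Let G be a connected finite simple graph with n vertices and m edges achieving the least value of TI among all connected graphs with n vertices and m edges. Then G is an almost regular graph, i.e., Δ(G) − δ(G) ≤ 1. -/
attribute [local instance] Classical.propDecidable

/-- The vertex-degree-based topological index `TI(G) = Σ_{uv ∈ E(G)} I(d_u, d_v)`
(the summand is symmetrized, which agrees with `I(d_u,d_v)` when `I` is symmetric). -/
noncomputable def vdbTI {V : Type*} [Fintype V] (I : ℝ → ℝ → ℝ) (G : SimpleGraph V) : ℝ :=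
  ∑ e ∈ G.edgeFinset, Sym2.lift
    ⟨fun u v => (I (G.degree u) (G.degree v) + I (G.degree v) (G.degree u)) / 2,
     fun _ _ => by ring⟩ e

/-- Property P: `I(x,y)` is monotonically increasing in `x` and, for any `a ≥ b ≥ 0`,
`h(x) = I(a,x) - I(b,x)` is monotonically decreasing in `x`. -/
def PropertyP (I : ℝ → ℝ → ℝ) : Prop :=
  (∀ y : ℝ, 1 ≤ y → MonotoneOn (fun x => I x y) (Set.Ici 1)) ∧
  (∀ a b : ℝ, 0 ≤ b → b ≤ a → AntitoneOn (fun x => I a x - I b x) (Set.Ici 1))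

/-- Property P*: property P together with `H(a,b) > 0` for all integers `a > b + 1 ≥ 2`,
where `H(a,b) = a[I(a,a) - I(a-1,a)] - b[I(b+1,b) - I(b,b)]`. -/
def PropertyPStar (I : ℝ → ℝ → ℝ) : Prop :=
  PropertyP I ∧
  ∀ a b : ℕ, 2 ≤ b + 1 → b + 1 < a →
    0 < (a : ℝ) * (I a a - I ((a : ℝ) - 1) a) - (b : ℝ) * (I ((b : ℝ) + 1) b - I b b)

namespace SimpleGraph

variable {V : Type*}

theorem Reachable.of_forall_adj_reachable {G H : SimpleGraph V}
    (h : ∀ x y, G.Adj x y → H.Reachable x y) {x y : V} (hxy : G.Reachable x y) :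
    H.Reachable x y := by
  obtain ⟨p⟩ := hxy
  induction p with
  | nil => exact Reachable.refl _
  | cons hadj _ ih => exact (h _ _ hadj).trans ih

/-- The graph obtained from `G` by replacing the edge `uw` with the edge `vw`. -/
def moveEdge (G : SimpleGraph V) (u v w : V) : SimpleGraph V :=
  G.deleteEdges {s(u, w)} ⊔ edge v w

theorem moveEdge_connected {G : SimpleGraph V} (hG : G.Connected) {u v w : V} (hvw : v ≠ w)
    (p : G.Walk u v) (hp : s(u, w) ∉ p.edges) : (G.moveEdge u v w).Connected := by
  have hdel : ∀ x y, G.Adj x y → s(x, y) ≠ s(u, w) → (G.moveEdge u v w).Adj x y := by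
    intro x y hxy hne
    exact Or.inl (by simpa [deleteEdges_adj] using ⟨hxy, by simpa using hne⟩)
  have hvw' : (G.moveEdge u v w).Adj v w := Or.inr (by simp [edge_adj, hvw])
  have huv : (G.moveEdge u v w).Reachable u v := by
    refine ⟨p.transfer _ fun e he => ?_⟩
    induction e with
    | _ x y => exact hdel x y (p.edges_subset_edgeSet he) fun h => hp (h ▸ he)
  have huw := huv.trans hvw'.reachable
  have := hG.nonempty
  refine ⟨fun x y => Reachable.of_forall_adj_reachable (fun x y hxy => ?_) (hG.preconnected x y)⟩
  by_cases h : s(x, y) = s(u, w)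
  · rcases Sym2.eq_iff.mp h with ⟨rfl, rfl⟩ | ⟨rfl, rfl⟩
    exacts [huw, huw.symm]
  · exact (hdel x y hxy h).reachable

/-- If the degree of `u` exceeds that of `v` by at least two, some edge at `u` can be moved
to `v` without disconnecting the graph. -/
theorem exists_moveEdge_connected [Fintype V] {G : SimpleGraph V} (hG : G.Connected) {u v : V}
    (hdeg : G.degree v + 1 < G.degree u) :
    ∃ w, G.Adj u w ∧ w ≠ v ∧ ¬ G.Adj v w ∧ (G.moveEdge u v w).Connected := by
  obtain ⟨p, hp⟩ := (hG.preconnected u v).exists_isPath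
  cases p with
  | nil => omega
  | @cons _ x _ hux q =>
    rw [Walk.cons_isPath_iff] at hp
    obtain ⟨w, hw, hwx, hwv, hvw⟩ : ∃ w, G.Adj u w ∧ w ≠ x ∧ w ≠ v ∧ ¬ G.Adj v w := by
      by_contra! hcon
      by_cases huv : G.Adj u v
      · have hsub : G.neighborFinset u ⊆
            insert x (insert v ((G.neighborFinset v).erase u)) := by
          intro w hw
          have hw' : G.Adj u w := by simpa using hw
          simp only [Finset.mem_insert, Finset.mem_erase, mem_neighborFinset]
          by_cases h1 : w = x
          · exact Or.inl h1
          by_cases h2 : w = v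
          · exact Or.inr (Or.inl h2)
          exact Or.inr (Or.inr ⟨hw'.ne', hcon w hw' h1 h2⟩)
        have hcard := Finset.card_le_card hsub
        have h1 := Finset.card_insert_le x (insert v ((G.neighborFinset v).erase u))
        have h2 := Finset.card_insert_le v ((G.neighborFinset v).erase u)
        have h3 := Finset.card_erase_add_one
          (show u ∈ G.neighborFinset v by simpa using huv.symm)
        simp only [card_neighborFinset_eq_degree] at *
        omega
      · have hsub : G.neighborFinset u ⊆ insert x (G.neighborFinset v) := by
          intro w hw
          have hw' : G.Adj u w := by simpa using hw
          simp only [Finset.mem_insert, mem_neighborFinset]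
          by_cases h1 : w = x
          · exact Or.inl h1
          exact Or.inr (hcon w hw' h1 (by rintro rfl; exact huv hw'))
        have hcard := Finset.card_le_card hsub
        have h1 := Finset.card_insert_le x (G.neighborFinset v)
        simp only [card_neighborFinset_eq_degree] at *
        omega
    refine ⟨w, hw, hwv, hvw, moveEdge_connected hG hwv.symm (Walk.cons hux q) ?_⟩
    rw [Walk.edges_cons, List.mem_cons, not_or]
    refine ⟨fun h => hwx (Sym2.congr_right.mp h), fun h => hp.2 (q.fst_mem_support_of_mem_edges h)⟩

section Finite

variable [Fintype V]

theorem edgeFinset_moveEdge (G : SimpleGraph V) {u v w : V} (hvw : v ≠ w) :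
    (G.moveEdge u v w).edgeFinset = insert s(v, w) (G.edgeFinset.erase s(u, w)) := by
  ext e
  rw [mem_edgeFinset]
  simp only [moveEdge, edgeSet_sup, edgeSet_deleteEdges, edgeSet_edge_of_ne hvw,
    Finset.mem_insert, Finset.mem_erase, Set.mem_union, Set.mem_sdiff, Set.mem_singleton_iff,
    mem_edgeFinset]
  tauto

theorem sum_edgeFinset_moveEdge {M : Type*} [AddCommMonoid M] (G : SimpleGraph V) {u v w : V}
    (hvw : v ≠ w) (hnadj : ¬ G.Adj v w) (f : Sym2 V → M) :
    ∑ e ∈ (G.moveEdge u v w).edgeFinset, f e =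
      f s(v, w) + ∑ e ∈ G.edgeFinset.erase s(u, w), f e := by
  rw [edgeFinset_moveEdge G hvw, Finset.sum_insert]
  simp [hnadj]

theorem card_edgeFinset_moveEdge (G : SimpleGraph V) {u v w : V} (huw : G.Adj u w) (hvw : v ≠ w)
    (hnadj : ¬ G.Adj v w) : (G.moveEdge u v w).edgeFinset.card = G.edgeFinset.card := by
  rw [Finset.card_eq_sum_ones, Finset.card_eq_sum_ones, sum_edgeFinset_moveEdge G hvw hnadj]
  exact Finset.add_sum_erase _ (fun _ => 1) (show s(u, w) ∈ G.edgeFinset by simpa using huw)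

theorem degree_eq_sum_edgeFinset (G : SimpleGraph V) (x : V) :
    G.degree x = ∑ e ∈ G.edgeFinset, if x ∈ e then 1 else 0 := by
  rw [← card_incidenceFinset_eq_degree, incidenceFinset_eq_filter, Finset.card_filter]

theorem degree_moveEdge (G : SimpleGraph V) {u v w : V} (huw : G.Adj u w) (hvw : v ≠ w)
    (hnadj : ¬ G.Adj v w) (x : V) :
    (G.moveEdge u v w).degree x + (if x ∈ s(u, w) then 1 else 0) =
      G.degree x + (if x ∈ s(v, w) then 1 else 0) := by
  rw [degree_eq_sum_edgeFinset, degree_eq_sum_edgeFinset, sum_edgeFinset_moveEdge G hvw hnadj,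
    ← Finset.add_sum_erase G.edgeFinset _ (show s(u, w) ∈ G.edgeFinset by simpa using huw)]
  ring

end Finite

end SimpleGraph

/-- Moving an edge from a vertex of maximum degree to one of minimum degree lowers the index. -/
theorem vdbTI_moveEdge_lt {V : Type*} [Fintype V] {I : ℝ → ℝ → ℝ}
    (hsym : ∀ x y : ℝ, 1 ≤ x → 1 ≤ y → I x y = I y x) (hP : PropertyPStar I)
    {G : SimpleGraph V} {u v w : V} (hmax : ∀ x, G.degree x ≤ G.degree u)
    (hmin : ∀ x, G.degree v ≤ G.degree x) (hpos : 1 ≤ G.degree v)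
    (hdeg : G.degree v + 1 < G.degree u) (huw : G.Adj u w) (hvw : v ≠ w)
    (hnadj : ¬ G.Adj v w) : vdbTI I (G.moveEdge u v w) < vdbTI I G := by
  obtain ⟨⟨hmono, hanti⟩, hH⟩ := hP
  have huv : u ≠ v := by rintro rfl; omega
  have hwu := huw.ne'
  have hd := G.degree_moveEdge huw hvw hnadj
  set G' := G.moveEdge u v w
  have hdu : (G'.degree u : ℝ) = G.degree u - 1 := by
    have := hd u
    simp [huv, hwu.symm] at this
    rw [← this]; push_cast; ring
  have hdv : (G'.degree v : ℝ) = G.degree v + 1 := by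
    have := hd v
    simp [huv.symm, hvw] at this
    rw [this]; push_cast; ring
  have hdx : ∀ x, x ≠ u → x ≠ v → (G'.degree x : ℝ) = G.degree x := by
    intro x hxu hxv
    have := hd x
    simp [hxu, hxv] at this
    rw [this]
  have hb1 : (1 : ℝ) ≤ G.degree v := by exact_mod_cast hpos
  have hab : (G.degree v : ℝ) + 2 ≤ G.degree u := by exact_mod_cast hdeg
  have hle : ∀ x, (G.degree x : ℝ) ≤ G.degree u := fun x => by exact_mod_cast hmax x
  have hge : ∀ x, (G.degree v : ℝ) ≤ G.degree x := fun x => by exact_mod_cast hmin x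
  have hHab := hH (G.degree u) (G.degree v) (by omega) hdeg
  set a := (G.degree u : ℝ) with ha
  set b := (G.degree v : ℝ) with hb
  set A := I a a - I (a - 1) a
  set B := I (b + 1) b - I b b
  have hAle : ∀ t : ℝ, 1 ≤ t → t ≤ a → A ≤ I a t - I (a - 1) t := fun t h1 h2 =>
    hanti a (a - 1) (by linarith) (by linarith) h1 (h1.trans h2) h2
  have hBge : ∀ t : ℝ, b ≤ t → I (b + 1) t - I b t ≤ B := fun t h =>
    hanti (b + 1) b (by linarith) (by linarith) hb1 (hb1.trans h) h
  let F (d : V → ℝ) (e : Sym2 V) : ℝ := Sym2.lift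
    ⟨fun x y => (I (d x) (d y) + I (d y) (d x)) / 2, fun _ _ => by ring⟩ e
  have hF : ∀ (d : V → ℝ) (x y : V), 1 ≤ d x → 1 ≤ d y → F d s(x, y) = I (d x) (d y) := by
    intro d x y hx hy
    change (I (d x) (d y) + I (d y) (d x)) / 2 = _
    rw [hsym _ _ hy hx]; ring
  let d (x : V) : ℝ := G.degree x
  let d' (x : V) : ℝ := G'.degree x
  have hd1 : ∀ x, 1 ≤ d x := fun x => hb1.trans (hge x)
  have hd1' : ∀ x, 1 ≤ d' x := by
    intro x
    by_cases hxu : x = u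
    · subst hxu; simp only [d', hdu]; linarith
    by_cases hxv : x = v
    · subst hxv; simp only [d', hdv]; linarith
    simp only [d', hdx x hxu hxv]; exact hd1 x
  have hmoved : A ≤ F d s(u, w) - F d' s(v, w) := by
    rw [hF d _ _ (hd1 _) (hd1 _), hF d' _ _ (hd1' _) (hd1' _)]
    simp only [d, d', hdv, hdx w hwu hvw.symm, ← ha]
    have h1 := hmono (G.degree w) (hd1 w) (show b + 1 ∈ Set.Ici (1 : ℝ) by
      simp only [Set.mem_Ici]; linarith) (show a - 1 ∈ Set.Ici (1 : ℝ) by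
      simp only [Set.mem_Ici]; linarith) (by linarith)
    have h2 := hAle _ (hd1 w) (hle w)
    dsimp only at h1
    linarith
  -- Edges at `u` are handled with `u` written first, edges at `v` with `v` written first.
  have hu_edge : ∀ y, y ≠ u → A - (if v ∈ s(u, y) then B else 0) ≤ F d s(u, y) - F d' s(u, y) := by
    intro y hyu
    rw [hF d _ _ (hd1 _) (hd1 _), hF d' _ _ (hd1' _) (hd1' _)]
    by_cases hyv : y = v
    · subst hyv
      simp only [d, d', hdu, hdv, ← ha, ← hb, Sym2.mem_iff, or_true, if_true]
      have h1 := hAle b hb1 (by linarith)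
      have h2 := hBge (a - 1) (by linarith)
      rw [hsym (a - 1) b (by linarith) (by linarith)] at h1
      rw [hsym (a - 1) (b + 1) (by linarith) (by linarith)]
      linarith
    · simp only [d, d', hdu, hdx y hyu hyv, ← ha, Sym2.mem_iff, huv.symm, Ne.symm hyv, or_self,
        if_false, sub_zero]
      exact hAle _ (hd1 y) (hle y)
  have hv_edge : ∀ y, y ≠ u → y ≠ v → -B ≤ F d s(v, y) - F d' s(v, y) := by
    intro y hyu hyv
    rw [hF d _ _ (hd1 _) (hd1 _), hF d' _ _ (hd1' _) (hd1' _)]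
    simp only [d, d', hdv, hdx y hyu hyv, ← hb]
    have := hBge _ (hge y)
    linarith
  have hedge : ∀ e ∈ G.edgeFinset.erase s(u, w),
      A * (if u ∈ e then 1 else 0) - B * (if v ∈ e then 1 else 0) ≤ F d e - F d' e := by
    intro e he
    have he' : e ∈ G.edgeSet := by simpa using (Finset.mem_erase.mp he).2
    simp only [mul_ite, mul_one, mul_zero]
    by_cases hue : u ∈ e
    · obtain ⟨y, rfl⟩ := hue
      simpa using hu_edge y (G.ne_of_adj he').symm
    by_cases hve : v ∈ e
    · obtain ⟨y, rfl⟩ := hve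
      have hyu : y ≠ u := by rintro rfl; simp at hue
      simpa [hue] using hv_edge y hyu (G.ne_of_adj he').symm
    induction e with
    | _ x y =>
      simp only [Sym2.mem_iff, not_or] at hue hve
      rw [hF d _ _ (hd1 _) (hd1 _), hF d' _ _ (hd1' _) (hd1' _)]
      simp only [d, d', hdx x (Ne.symm hue.1) (Ne.symm hve.1),
        hdx y (Ne.symm hue.2) (Ne.symm hve.2), Sym2.mem_iff, hue, hve]
      simp
  have hmem : s(u, w) ∈ G.edgeFinset := by simpa using huw
  have hsum_u : ∑ e ∈ G.edgeFinset.erase s(u, w), (if u ∈ e then (1 : ℝ) else 0) = a - 1 := by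
    rw [ha, G.degree_eq_sum_edgeFinset u, ← Finset.add_sum_erase _ _ hmem]
    push_cast
    simp
  have hsum_v : ∑ e ∈ G.edgeFinset.erase s(u, w), (if v ∈ e then (1 : ℝ) else 0) = b := by
    rw [hb, G.degree_eq_sum_edgeFinset v, ← Finset.add_sum_erase _ _ hmem]
    push_cast
    simp [huv.symm, hvw]
  have hTI : vdbTI I G = F d s(u, w) + ∑ e ∈ G.edgeFinset.erase s(u, w), F d e :=
    (Finset.add_sum_erase _ _ hmem).symm
  have hTI' : vdbTI I G' = F d' s(v, w) + ∑ e ∈ G.edgeFinset.erase s(u, w), F d' e :=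
    G.sum_edgeFinset_moveEdge hvw hnadj (F d')
  have hsum := Finset.sum_le_sum hedge
  rw [Finset.sum_sub_distrib, Finset.sum_sub_distrib, ← Finset.mul_sum, ← Finset.mul_sum,
    hsum_u, hsum_v] at hsum
  rw [hTI, hTI']
  linarith

theorem minimal_vdb_almost_regular (n m : ℕ) (I : ℝ → ℝ → ℝ)
    (hsym : ∀ x y : ℝ, 1 ≤ x → 1 ≤ y → I x y = I y x)
    (hpos : ∀ x y : ℝ, 1 ≤ x → 1 ≤ y → 0 < I x y)
    (hP : PropertyPStar I)
    (G : SimpleGraph (Fin n)) (hconn : G.Connected) (hm : G.edgeFinset.card = m)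
    (hmin : ∀ H : SimpleGraph (Fin n), H.Connected → H.edgeFinset.card = m →
      vdbTI I G ≤ vdbTI I H) :
    G.maxDegree ≤ G.minDegree + 1 := by
  by_contra! hlt
  have := hconn.nonempty
  obtain ⟨u, hu⟩ := G.exists_maximal_degree_vertex
  obtain ⟨v, hv⟩ := G.exists_minimal_degree_vertex
  have hmax : ∀ x, G.degree x ≤ G.degree u := fun x => hu ▸ G.degree_le_maxDegree x
  have hmin' : ∀ x, G.degree v ≤ G.degree x := fun x => hv ▸ G.minDegree_le_degree x
  have hdeg : G.degree v + 1 < G.degree u := by rw [← hu, ← hv]; exact hlt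
  have huv : u ≠ v := by rintro rfl; omega
  have : Nontrivial (Fin n) := ⟨u, v, huv⟩
  have hpos' : 1 ≤ G.degree v := hconn.preconnected.degree_pos_of_nontrivial v
  obtain ⟨w, huw, hwv, hnadj, hconn'⟩ :=
    SimpleGraph.exists_moveEdge_connected (u := u) (v := v) hconn (by convert hdeg)
  refine (hmin _ hconn' ?_).not_gt (vdbTI_moveEdge_lt hsym hP (u := u) (v := v) (w := w)
    (fun x => by convert hmax x) (fun x => by convert hmin' x) (by convert hpos')
    (by convert hdeg) huw hwv.symm hnadj)
  rw [← hm]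
  convert G.card_edgeFinset_moveEdge huw hwv.symm hnadj
end

section
/- Let k be a positive integer and n ≥ 5(k−1). If G ∈ 𝒢_{n,k} satisfies δ(G) ≥ 2 and Δ(G) ≥ 4, then n₂(G) ≥ 4, i.e., G has at least four vertices of degree 2. -/
attribute [local instance] Classical.propDecidable

/-- `nDeg G i` is the number of vertices of `G` of degree `i`. -/
noncomputable def nDeg {V : Type*} [Fintype V] (G : SimpleGraph V) (i : ℕ) : ℕ :=
  (Finset.univ.filter (fun v => G.degree v = i)).card

theorem Finset.card_mul_add_le_sum {α : Type*} [Fintype α] (f : α → ℕ) (c d : ℕ)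
    (hf : ∀ a, c ≤ f a) (w : α) (hw : c + d ≤ f w) :
    Fintype.card α * c + d ≤ ∑ a, f a := by
  classical
  have hsum : ∑ a : α, (c + if a = w then d else 0) ≤ ∑ a, f a := by
    refine Finset.sum_le_sum fun a _ => ?_
    split_ifs with h
    · exact h ▸ hw
    · exact hf a
  simpa [Finset.sum_add_distrib] using hsum

theorem kcyclic_four_deg_two_vertices (n k : ℕ) (hk : 1 ≤ k) (hn : 5 * (k - 1) ≤ n)
    (G : SimpleGraph (Fin n)) (hconn : G.Connected) (hm : G.edgeFinset.card = n + k - 1)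
    (hδ : 2 ≤ G.minDegree) (hΔ : 4 ≤ G.maxDegree) :
    4 ≤ nDeg G 2 := by
  have := hconn.nonempty
  obtain ⟨w, hw⟩ := G.exists_maximal_degree_vertex
  have hdeg : ∀ v, 2 ≤ G.degree v := fun v => hδ.trans (G.minDegree_le_degree v)
  have hw4 : 4 ≤ G.degree w := hw ▸ hΔ
  have hsum := G.sum_degrees_eq_twice_card_edges
  have hexcess := Finset.card_mul_add_le_sum (fun v => G.degree v) 2 2 hdeg w hw4
  have hcount := Finset.card_mul_add_le_sum
    (fun v => G.degree v + if G.degree v = 2 then 1 else 0) 3 1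
    (fun v => by have := hdeg v; split_ifs <;> omega) w (by omega)
  rw [Finset.sum_add_distrib, ← Finset.card_filter] at hcount
  rw [Fintype.card_fin] at hexcess hcount
  unfold nDeg
  omega
end

section
/- Let k be a positive integer and n ≥ 5(k−1). If G ∈ 𝒢_{n,k} satisfies δ(G) ≥ 2 and Δ(G) ≥ 4, then m_{2,2}(G) ≥ 1, i.e., G has at least one edge both of whose endpoints have degree 2. -/
attribute [local instance] Classical.propDecidable

/-- `mDeg G i j` is the number of edges of `G` joining a vertex of degree `i`
with a vertex of degree `j`. -/
noncomputable def mDeg {V : Type*} [Fintype V] (G : SimpleGraph V) (i j : ℕ) : ℕ :=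
  (G.edgeFinset.filter (fun e => Sym2.lift
    ⟨fun u v => (G.degree u = i ∧ G.degree v = j) ∨ (G.degree v = i ∧ G.degree u = j),
     fun _ _ => propext or_comm⟩ e)).card

/-- In a finite graph, the degrees over an independent set of vertices sum to at most the degrees
over its complement. -/
theorem SimpleGraph.sum_degree_le_sum_degree_compl_of_isIndepSet {V : Type*} [Fintype V]
    [DecidableEq V] (G : SimpleGraph V) [DecidableRel G.Adj] (A : Finset V)
    (hA : ∀ u ∈ A, ∀ v ∈ A, ¬ G.Adj u v) :
    ∑ v ∈ A, G.degree v ≤ ∑ w ∈ Aᶜ, G.degree w := by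
  calc ∑ v ∈ A, G.degree v = ∑ v ∈ A, (Finset.bipartiteAbove G.Adj Aᶜ v).card := by
        refine Finset.sum_congr rfl fun v hv => ?_
        rw [← G.card_neighborFinset_eq_degree]
        congr 1
        ext w
        simp only [SimpleGraph.mem_neighborFinset, Finset.mem_bipartiteAbove, Finset.mem_compl]
        exact ⟨fun h => ⟨fun hw => hA v hv w hw h, h⟩, fun h => h.2⟩
    _ = ∑ w ∈ Aᶜ, (Finset.bipartiteBelow G.Adj A w).card :=
        Finset.sum_card_bipartiteAbove_eq_sum_card_bipartiteBelow _
    _ ≤ ∑ w ∈ Aᶜ, G.degree w := by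
        refine Finset.sum_le_sum fun w _ => ?_
        rw [← G.card_neighborFinset_eq_degree]
        refine Finset.card_le_card fun v hv => ?_
        rw [SimpleGraph.mem_neighborFinset]
        exact ((Finset.mem_bipartiteBelow _).1 hv).2.symm

theorem one_le_mDeg_of_adj {V : Type*} [Fintype V] (G : SimpleGraph V) {u v : V}
    (h : G.Adj u v) : 1 ≤ mDeg G (G.degree u) (G.degree v) := by
  refine Finset.card_pos.2 ⟨s(u, v), Finset.mem_filter.2 ⟨?_, Or.inl ⟨rfl, rfl⟩⟩⟩
  exact SimpleGraph.mem_edgeFinset.2 h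

theorem kcyclic_deg22_edge (n k : ℕ) (hk : 1 ≤ k) (hn : 5 * (k - 1) ≤ n)
    (G : SimpleGraph (Fin n)) (hconn : G.Connected) (hm : G.edgeFinset.card = n + k - 1)
    (hδ : 2 ≤ G.minDegree) (hΔ : 4 ≤ G.maxDegree) :
    1 ≤ mDeg G 2 2 := by
  by_contra hcon
  have hdeg : ∀ v, 2 ≤ G.degree v := fun v => hδ.trans (G.minDegree_le_degree v)
  set A : Finset (Fin n) := Finset.univ.filter fun v => G.degree v = 2 with hAdef
  have hmemA : ∀ v, v ∈ A ↔ G.degree v = 2 := fun v => by simp [hAdef]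
  have hindep : ∀ u ∈ A, ∀ v ∈ A, ¬ G.Adj u v := by
    intro u hu v hv huv
    have h := one_le_mDeg_of_adj G huv
    rw [(hmemA u).1 hu, (hmemA v).1 hv] at h
    exact hcon h
  have hle := G.sum_degree_le_sum_degree_compl_of_isIndepSet A hindep
  have hsumA : ∑ v ∈ A, G.degree v = A.card * 2 :=
    Finset.sum_const_nat fun v hv => (hmemA v).1 hv
  have hsum : ∑ v ∈ A, G.degree v + ∑ v ∈ Aᶜ, G.degree v = 2 * G.edgeFinset.card := by
    rw [Finset.sum_add_sum_compl, G.sum_degrees_eq_twice_card_edges]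
  have hcard : A.card + Aᶜ.card = n := by
    rw [Finset.card_add_card_compl, Fintype.card_fin]
  have : Nonempty (Fin n) := hconn.nonempty
  obtain ⟨x, hx⟩ := G.exists_maximal_degree_vertex
  have hlt : ∑ _v ∈ Aᶜ, 3 < ∑ v ∈ Aᶜ, G.degree v := by
    refine Finset.sum_lt_sum (fun v hv => ?_) ⟨x, ?_, by omega⟩
    · have := hdeg v
      have : G.degree v ≠ 2 := fun h => Finset.mem_compl.1 hv ((hmemA v).2 h)
      omega
    · rw [Finset.mem_compl, hmemA]
      omega
  rw [Finset.sum_const, smul_eq_mul] at hlt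
  omega
end

section
/- Let I(x,y) be a symmetric positive real function with property P*, and let TI be the associated VDB topological index. Let k ≥ 3 and n ≥ 5(k−1). If G is a graph achieving the least value of TI over 𝒢_{n,k}, then Δ(G) = 3. -/
attribute [local instance] Classical.propDecidable

namespace SimpleGraph

variable {V : Type*}

/-- Adding a new edge `st` raises the degrees of `s` and `t` by one and no others. -/
lemma degree_of_eq_sup_edge [Fintype V] {G K : SimpleGraph V} {s t : V}
    (hG : G = K ⊔ edge s t) (hst : s ≠ t) (hK : ¬K.Adj s t) (x : V) :
    G.degree x = K.degree x + if x = s ∨ x = t then 1 else 0 := by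
  have hK' : ¬K.Adj t s := fun h => hK h.symm
  simp only [← card_neighborFinset_eq_degree]
  by_cases hs : x = s
  · subst hs
    have : G.neighborFinset x = insert t (K.neighborFinset x) := by
      ext y; simp only [hG, mem_neighborFinset, sup_adj, edge_adj, Finset.mem_insert]; grind
    rw [this, Finset.card_insert_of_notMem (by simpa using hK)]
    simp
  · by_cases ht : x = t
    · subst ht
      have : G.neighborFinset x = insert s (K.neighborFinset x) := by
        ext y; simp only [hG, mem_neighborFinset, sup_adj, edge_adj, Finset.mem_insert]; grind
      rw [this, Finset.card_insert_of_notMem (by simpa using hK')]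
      simp
    · have : G.neighborFinset x = K.neighborFinset x := by
        ext y; simp only [hG, mem_neighborFinset, sup_adj, edge_adj]; grind
      simp [this, hs, ht]

lemma edgeFinset_of_eq_sup_edge [Fintype V] {G K : SimpleGraph V} {s t : V}
    (hG : G = K ⊔ edge s t) (hst : s ≠ t) : G.edgeFinset = insert s(s, t) K.edgeFinset := by
  ext e
  simp [hG, edgeSet_edge_of_ne hst]

lemma sum_edgeFinset_ite_mem [Fintype V] (K : SimpleGraph V) (x : V) (c : ℝ) :
    ∑ e ∈ K.edgeFinset, (if x ∈ e then c else 0) = K.degree x * c := by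
  rw [← Finset.sum_filter, Finset.sum_const, nsmul_eq_mul, ← incidenceFinset_eq_filter,
    card_incidenceFinset_eq_degree]

/-- Moving an edge from `u` to `v` keeps the graph connected if `u` and `v` stay connected. -/
lemma Connected.sup_edge_of_reachable {K : SimpleGraph V} {u v w : V} (hvw : v ≠ w)
    (hG : (K ⊔ edge u w).Connected) (huv : K.Reachable u v) : (K ⊔ edge v w).Connected := by
  have huv' : (K ⊔ edge v w).Reachable u v := huv.mono le_sup_left
  have hvw' : (K ⊔ edge v w).Reachable v w :=
    Adj.reachable (by simp [edge_adj, hvw])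
  have key : ∀ x y, (K ⊔ edge u w).Walk x y → (K ⊔ edge v w).Reachable x y := by
    intro x y p
    induction p with
    | nil => exact .rfl
    | cons h _ ih =>
      refine .trans ?_ ih
      rw [sup_adj, edge_adj] at h
      rcases h with h | ⟨⟨rfl, rfl⟩ | ⟨rfl, rfl⟩, -⟩
      · exact Adj.reachable (by simp [h])
      · exact huv'.trans hvw'
      · exact (huv'.trans hvw').symm
  have := hG.nonempty
  exact ⟨fun x y => (hG.preconnected x y).elim (key x y)⟩

/-- Some vertex `p`, equal to `v` if `u` and `v` are adjacent, is such that deleting any edge at `u`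
other than `up` leaves `u` and `v` connected. -/
lemma Connected.exists_adj_reachable_deleteEdges {G : SimpleGraph V} (hG : G.Connected) {u v : V}
    (huv : u ≠ v) : ∃ p, (G.Adj u v → p = v) ∧
      ∀ w, w ≠ p → (G.deleteEdges {s(u, w)}).Reachable u v := by
  by_cases h : G.Adj u v
  · exact ⟨v, fun _ => rfl, fun w hw => Adj.reachable (by
      simp [h, hw.symm, huv.symm])⟩
  · obtain ⟨q, hq⟩ := (hG.preconnected u v).exists_isPath
    cases q with
    | nil => exact absurd rfl huv
    | @cons _ p _ hup q =>
      refine ⟨p, fun h' => absurd h' h, fun w hw => ⟨(Walk.cons hup q).toDeleteEdge _ ?_⟩⟩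
      rw [Walk.cons_isPath_iff] at hq
      rw [Walk.edges_cons, List.mem_cons, not_or]
      refine ⟨?_, fun hmem => hq.2 (q.fst_mem_support_of_mem_edges hmem)⟩
      simp only [Sym2.eq_iff]
      rintro (⟨-, h⟩ | ⟨h, -⟩)
      · exact hw h
      · exact hup.ne h

end SimpleGraph

open SimpleGraph

/-- Moving an edge from a vertex of maximal degree `a` to a vertex of minimal degree `b < a - 1`
strictly decreases the index. -/
lemma vdbTI_sup_edge_lt {V : Type*} [Fintype V] {I : ℝ → ℝ → ℝ}
    (hsym : ∀ x y : ℝ, 1 ≤ x → 1 ≤ y → I x y = I y x) (hP : PropertyPStar I)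
    {G H K : SimpleGraph V} {u v w : V} {a b : ℕ} (hG : G = K ⊔ edge u w) (hH : H = K ⊔ edge v w)
    (huw : u ≠ w) (hvw : v ≠ w)
    (hKu : ¬K.Adj u w) (hKv : ¬K.Adj v w)
    (ha : ∀ x, G.degree x ≤ a) (hb : ∀ x, b ≤ G.degree x)
    (hu : G.degree u = a) (hv : G.degree v = b)
    (hb1 : 1 ≤ b) (hab : b + 1 < a) :
    vdbTI I H < vdbTI I G := by
  obtain ⟨⟨hmono, hanti⟩, hPos⟩ := hP
  have huv : u ≠ v := by rintro rfl; omega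
  have hKa : K.degree u + 1 = a := by
    rw [← hu, degree_of_eq_sup_edge hG huw hKu]; simp
  have hKb : K.degree v = b := by
    rw [← hv, degree_of_eq_sup_edge hG huw hKu]; simp [huv.symm, hvw]
  set g : V → ℕ := fun x => G.degree x with hg
  set h : V → ℕ := fun x => H.degree x with hh
  have hhu : (h u : ℝ) = a - 1 := by
    rw [← hKa]; simp [hh, degree_of_eq_sup_edge hH hvw hKv, huv, huw]
  have hhv : (h v : ℝ) = b + 1 := by
    rw [← hKb]; simp [hh, degree_of_eq_sup_edge hH hvw hKv]
  have hhx : ∀ x, x ≠ u → x ≠ v → h x = g x := by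
    intro x hxu hxv
    simp [hh, hg, degree_of_eq_sup_edge hH hvw hKv, degree_of_eq_sup_edge hG huw hKu, hxu, hxv]
  have hgu : g u = a := hu
  have hgv : g v = b := hv
  have hga : ∀ x, (g x : ℝ) ≤ a := fun x => by exact_mod_cast ha x
  have hgb : ∀ x, (b : ℝ) ≤ g x := fun x => by exact_mod_cast hb x
  have hb1' : (1 : ℝ) ≤ b := by exact_mod_cast hb1
  have hab' : (b : ℝ) + 2 ≤ a := by exact_mod_cast hab
  set A : ℝ := I a a - I ((a : ℝ) - 1) a with hA
  set B : ℝ := I ((b : ℝ) + 1) b - I b b with hB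
  have hAle : ∀ d : ℝ, 1 ≤ d → d ≤ a → A ≤ I a d - I (a - 1) d := fun d hd hda =>
    hanti a (a - 1) (by linarith) (by linarith) hd (hd.trans hda) hda
  have hBle : ∀ d : ℝ, b ≤ d → I (b + 1) d - I b d ≤ B := fun d hd =>
    hanti (b + 1) b (by linarith) (by linarith) hb1' (hb1'.trans hd) hd
  have hu_only : ∀ y, y ≠ u → y ≠ v →
      A ≤ I (g u) (g y) - I (h u) (h y) := by
    intro y hyu hyv
    rw [hhx y hyu hyv, hgu, hhu]
    exact hAle _ (hb1'.trans (hgb y)) (hga y)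
  have hv_only : ∀ y, y ≠ u → y ≠ v →
      -B ≤ I (g v) (g y) - I (h v) (h y) := by
    intro y hyu hyv
    rw [hhx y hyu hyv, hgv, hhv]
    linarith [hBle _ (hgb y)]
  have huv_both : A - B ≤ I (g u) (g v) - I (h u) (h v) := by
    rw [hgu, hgv, hhu, hhv]
    have h1 := hAle b hb1' (by linarith)
    have h2 := hBle (a - 1) (by linarith)
    rw [hsym (b + 1) (a - 1) (by linarith) (by linarith),
      hsym b (a - 1) hb1' (by linarith)] at h2
    linarith
  have hg1 : ∀ x, (1 : ℝ) ≤ g x := fun x => hb1'.trans (hgb x)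
  have hh1 : ∀ x, (1 : ℝ) ≤ h x := by
    intro x
    by_cases hxu : x = u
    · rw [hxu, hhu]; linarith
    by_cases hxv : x = v
    · rw [hxv, hhv]; linarith
    rw [hhx x hxu hxv]; exact hg1 x
  have hgsym : ∀ x y, I (g x) (g y) = I (g y) (g x) := fun x y => hsym _ _ (hg1 x) (hg1 y)
  have hhsym : ∀ x y, I (h x) (h y) = I (h y) (h x) := fun x y => hsym _ _ (hh1 x) (hh1 y)
  have hpair : ∀ x y, x ≠ y → (if u ∈ s(x, y) then A else 0) - (if v ∈ s(x, y) then B else 0) ≤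
      I (g x) (g y) - I (h x) (h y) := by
    intro x y hxy
    by_cases hxu : x = u
    · subst hxu
      by_cases hyv : y = v
      · subst hyv; simpa using huv_both
      · simpa [huv.symm, Ne.symm hyv] using hu_only y hxy.symm hyv
    by_cases hxv : x = v
    · subst hxv
      by_cases hyu : y = u
      · subst hyu; rw [hgsym, hhsym]; simpa using huv_both
      · simpa [huv, Ne.symm hyu] using hv_only y hyu hxy.symm
    by_cases hyu : y = u
    · subst hyu; rw [hgsym, hhsym]
      simpa [huv.symm, Ne.symm hxv, Ne.symm hxu] using hu_only x hxu hxv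
    by_cases hyv : y = v
    · subst hyv; rw [hgsym, hhsym]
      simpa [huv, Ne.symm hxv, Ne.symm hxu] using hv_only x hxu hxv
    simp [hhx x hxu hxv, hhx y hyu hyv, Ne.symm hxu, Ne.symm hxv, Ne.symm hyu, Ne.symm hyv]
  have hmoved : A ≤ I (g u) (g w) - I (h v) (h w) := by
    have h1 := hu_only w huw.symm hvw.symm
    have h2 := hmono (h w) (hh1 w) (hh1 v) (hh1 u) (by rw [hhu, hhv]; linarith)
    simp only at h2
    linarith
  have hsum : K.degree u * A - K.degree v * B ≤
      (∑ e ∈ K.edgeFinset, Sym2.lift ⟨fun x y => (I (g x) (g y) + I (g y) (g x)) / 2,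
        fun _ _ => by ring⟩ e) -
      ∑ e ∈ K.edgeFinset, Sym2.lift ⟨fun x y => (I (h x) (h y) + I (h y) (h x)) / 2,
        fun _ _ => by ring⟩ e := by
    rw [← sum_edgeFinset_ite_mem, ← sum_edgeFinset_ite_mem, ← Finset.sum_sub_distrib,
      ← Finset.sum_sub_distrib]
    refine Finset.sum_le_sum fun e he => ?_
    induction e with
    | h x y =>
      have := hpair x y (K.ne_of_adj (by simpa using he))
      simp only [Sym2.lift_mk]
      rw [hgsym y x, hhsym y x]
      linarith
  have hdeg := hPos a b (by omega) hab
  have hKa' : (K.degree u : ℝ) = a - 1 := by rw [← hKa]; simp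
  rw [hKa', hKb] at hsum
  unfold vdbTI
  rw [edgeFinset_of_eq_sup_edge hG huw, edgeFinset_of_eq_sup_edge hH hvw,
    Finset.sum_insert (by simpa using hKv), Finset.sum_insert (by simpa using hKu)]
  simp only [Sym2.lift_mk]
  change _ / 2 + ∑ e ∈ K.edgeFinset, Sym2.lift ⟨fun x y => (I (h x) (h y) + I (h y) (h x)) / 2,
        fun _ _ => by ring⟩ e <
    _ / 2 + ∑ e ∈ K.edgeFinset, Sym2.lift ⟨fun x y => (I (g x) (g y) + I (g y) (g x)) / 2,
        fun _ _ => by ring⟩ e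
  change (I (h v) (h w) + I (h w) (h v)) / 2 + _ < (I (g u) (g w) + I (g w) (g u)) / 2 + _
  rw [hgsym w u, hhsym w v]
  linarith

/-- In a connected graph minimizing the index among those with its number of edges,
the degrees differ by at most one. -/
lemma maxDegree_le_minDegree_add_one_of_vdbTI_minimal {V : Type*} [Fintype V] [Nontrivial V]
    {I : ℝ → ℝ → ℝ}
    (hsym : ∀ x y : ℝ, 1 ≤ x → 1 ≤ y → I x y = I y x) (hP : PropertyPStar I)
    {G : SimpleGraph V} (hconn : G.Connected)
    (hmin : ∀ H : SimpleGraph V, H.Connected → H.edgeFinset.card = G.edgeFinset.card →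
      vdbTI I G ≤ vdbTI I H) :
    G.maxDegree ≤ G.minDegree + 1 := by
  by_contra! hlt
  obtain ⟨u, hu⟩ := G.exists_maximal_degree_vertex
  obtain ⟨v, hv⟩ := G.exists_minimal_degree_vertex
  have huv : u ≠ v := by rintro rfl; omega
  obtain ⟨p, hpv, hp⟩ := hconn.exists_adj_reachable_deleteEdges huv
  obtain ⟨w, hw, hw'⟩ : ∃ w ∈ G.neighborFinset u, w ∉ insert p (G.neighborFinset v) := by
    apply Finset.exists_mem_notMem_of_card_lt_card
    refine (Finset.card_insert_le _ _).trans_lt ?_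
    rw [card_neighborFinset_eq_degree, card_neighborFinset_eq_degree]
    omega
  rw [mem_neighborFinset] at hw
  rw [Finset.mem_insert, not_or, mem_neighborFinset] at hw'
  have hvw : v ≠ w := by rintro rfl; exact hw'.1 (hpv hw).symm
  have hreach := hp w hw'.1
  set K := G.deleteEdges {s(u, w)} with hK
  have hGK : G = K ⊔ edge u w := by
    ext x y
    have := hw.symm
    simp only [hK, sup_adj, edge_adj, deleteEdges_adj, Set.mem_singleton_iff, Sym2.eq_iff]
    have : G.Adj x y → x ≠ y := fun h => h.ne
    grind
  have hKu : ¬K.Adj u w := by simp [hK]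
  have hKv : ¬K.Adj v w := fun h => hw'.2 (G.deleteEdges_le _ h)
  refine (vdbTI_sup_edge_lt hsym hP hGK rfl hw.ne hvw hKu hKv (fun x => degree_le_maxDegree _ x)
    (fun x => minDegree_le_degree _ x) hu.symm hv.symm
    hconn.preconnected.minDegree_pos_of_nontrivial hlt).not_ge
    (hmin _ ((hGK ▸ hconn).sup_edge_of_reachable hvw hreach) ?_)
  rw [edgeFinset_of_eq_sup_edge hGK hw.ne, edgeFinset_of_eq_sup_edge rfl hvw,
    Finset.card_insert_of_notMem (by simpa using hKv),
    Finset.card_insert_of_notMem (by simpa using hKu)]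

theorem minimal_vdb_kcyclic_maxDegree (n k : ℕ) (hk : 3 ≤ k) (hn : 5 * (k - 1) ≤ n)
    (I : ℝ → ℝ → ℝ)
    (hsym : ∀ x y : ℝ, 1 ≤ x → 1 ≤ y → I x y = I y x)
    (hpos : ∀ x y : ℝ, 1 ≤ x → 1 ≤ y → 0 < I x y)
    (hP : PropertyPStar I)
    (G : SimpleGraph (Fin n)) (hconn : G.Connected) (hm : G.edgeFinset.card = n + k - 1)
    (hmin : ∀ H : SimpleGraph (Fin n), H.Connected → H.edgeFinset.card = n + k - 1 →
      vdbTI I G ≤ vdbTI I H) :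
    G.maxDegree = 3 := by
  have : Nontrivial (Fin n) := Fin.nontrivial_iff_two_le.mpr (by omega)
  have hle : G.maxDegree ≤ G.minDegree + 1 := by
    have := maxDegree_le_minDegree_add_one_of_vdbTI_minimal hsym hP hconn
      fun H hH hcard => hmin H hH (by rw [← hm]; convert! hcard)
    convert! this
  have hsum := G.sum_degrees_eq_twice_card_edges
  have hcard : G.edgeFinset.card = n + k - 1 := by convert! hm
  rw [hcard] at hsum
  have hlow : n * G.minDegree ≤ ∑ x, G.degree x := by
    simpa using Finset.card_nsmul_le_sum Finset.univ (fun x => G.degree x) G.minDegree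
      fun x _ => G.minDegree_le_degree x
  have hupp : ∑ x, G.degree x ≤ n * G.maxDegree := by
    simpa using Finset.sum_le_card_nsmul Finset.univ (fun x => G.degree x) G.maxDegree
      fun x _ => G.degree_le_maxDegree x
  have hmin2 : G.minDegree ≤ 2 := by
    by_contra! h
    have := Nat.mul_le_mul_left n h
    omega
  have hmax3 : 3 ≤ G.maxDegree := by
    by_contra! h
    have := Nat.mul_le_mul_left n (Nat.le_of_lt_succ h)
    omega
  omega
end

section
/- Let k ≥ 3 and n ≥ 5(k−1). If G is a graph achieving the least value of the Sombor index SO over 𝒢_{n,k}, then G is a bidegreed graph with degree set {2,3}, m_{2,3}(G) = 2, m_{2,2}(G) = n − 2k + 1, m_{3,3}(G) = 3k − 4, and SO(G) = (2n + 5k − 10)√2 + 2√13. -/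
attribute [local instance] Classical.propDecidable

/-- The Sombor index `SO(G) = Σ_{uv ∈ E(G)} √(d_u² + d_v²)`. -/
noncomputable def somborIndex {V : Type*} [Fintype V] (G : SimpleGraph V) : ℝ :=
  vdbTI (fun x y => Real.sqrt (x ^ 2 + y ^ 2)) G

namespace SimpleGraph

variable {V : Type*} [Fintype V]

theorem sum_edgeFinset_lift_add (G : SimpleGraph V) (ψ : V → ℝ) :
    ∑ e ∈ G.edgeFinset, Sym2.lift ⟨fun u v => ψ u + ψ v, fun _ _ => add_comm _ _⟩ e =
      ∑ v, (G.degree v : ℝ) * ψ v := by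
  have h : ∀ e ∈ G.edgeFinset,
      Sym2.lift ⟨fun u v => ψ u + ψ v, fun _ _ => add_comm _ _⟩ e =
        ∑ v, if v ∈ e then ψ v else 0 := by
    intro e
    induction e using Sym2.ind with
    | _ u v =>
      intro he
      have huv : u ≠ v := G.ne_of_adj (by simpa using he)
      rw [← Finset.sum_filter]
      have : Finset.univ.filter (fun w => w ∈ s(u, v)) = {u, v} := by ext; simp
      rw [this, Finset.sum_pair huv]
      rfl
  rw [Finset.sum_congr rfl h, Finset.sum_comm]
  refine Finset.sum_congr rfl fun v _ => ?_
  rw [← Finset.sum_filter, Finset.sum_const, nsmul_eq_mul, ← G.card_incidenceFinset_eq_degree,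
    G.incidenceFinset_eq_filter]

/-- The amount by which `√(a² + b²)` exceeds the sum of the two vertex weights
`√2 (5/2 - 3/a)` and `√2 (5/2 - 3/b)`. -/
noncomputable def somborExcess (a b : ℝ) : ℝ :=
  √(a ^ 2 + b ^ 2) - (√2 * (5 / 2 - 3 / a) + √2 * (5 / 2 - 3 / b))

theorem somborExcess_comm (a b : ℝ) : somborExcess a b = somborExcess b a := by
  rw [somborExcess, somborExcess, add_comm (a ^ 2), add_comm (√2 * (5 / 2 - 3 / a))]

theorem somborExcess_ge {a b : ℝ} (ha : 0 < a) (hb : 0 < b) :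
    √2 / 2 * ((a - 2) * (a - 3) / a + (b - 2) * (b - 3) / b) ≤ somborExcess a b := by
  have h2 : √2 * √2 = 2 := Real.mul_self_sqrt (by norm_num)
  have h : √2 / 2 * (a + b) ≤ √(a ^ 2 + b ^ 2) := by
    apply Real.le_sqrt_of_sq_le
    nlinarith [sq_nonneg (a - b)]
  have e : √2 / 2 * ((a - 2) * (a - 3) / a + (b - 2) * (b - 3) / b) =
      √2 / 2 * (a + b) - (√2 * (5 / 2 - 3 / a) + √2 * (5 / 2 - 3 / b)) := by
    field_simp
    ring
  rw [somborExcess, e]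
  linarith

theorem natCast_sub_mul_sub_div_nonneg (a : ℕ) :
    (0 : ℝ) ≤ ((a : ℝ) - 2) * (a - 3) / a := by
  refine div_nonneg ?_ a.cast_nonneg
  rcases Nat.lt_or_ge a 3 with h | h
  · have : (a : ℝ) ≤ 2 := by exact_mod_cast Nat.le_of_lt_succ h
    nlinarith
  · have : (3 : ℝ) ≤ a := by exact_mod_cast h
    nlinarith

theorem half_le_natCast_sub_mul_sub_div {a : ℕ} (h0 : 0 < a) (h2 : a ≠ 2) (h3 : a ≠ 3) :
    (1 / 2 : ℝ) ≤ ((a : ℝ) - 2) * (a - 3) / a := by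
  rw [le_div_iff₀ (by exact_mod_cast h0)]
  rcases Nat.lt_or_ge a 4 with h | h
  · obtain rfl : a = 1 := by omega
    norm_num
  · have : (4 : ℝ) ≤ a := by exact_mod_cast h
    nlinarith

theorem somborExcess_nonneg {a b : ℕ} (ha : 0 < a) (hb : 0 < b) :
    0 ≤ somborExcess a b := by
  refine le_trans ?_ (somborExcess_ge (Nat.cast_pos.2 ha) (Nat.cast_pos.2 hb))
  have := natCast_sub_mul_sub_div_nonneg a
  have := natCast_sub_mul_sub_div_nonneg b
  positivity

theorem somborExcess_two_two : somborExcess 2 2 = 0 := by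
  have : √((2 : ℝ) ^ 2 + 2 ^ 2) = 2 * √2 := by
    rw [show (2 : ℝ) ^ 2 + 2 ^ 2 = 2 ^ 2 * 2 by norm_num, Real.sqrt_mul (by norm_num),
      Real.sqrt_sq (by norm_num)]
  rw [somborExcess, this]
  ring

theorem somborExcess_three_three : somborExcess 3 3 = 0 := by
  have : √((3 : ℝ) ^ 2 + 3 ^ 2) = 3 * √2 := by
    rw [show (3 : ℝ) ^ 2 + 3 ^ 2 = 3 ^ 2 * 2 by norm_num, Real.sqrt_mul (by norm_num),
      Real.sqrt_sq (by norm_num)]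
  rw [somborExcess, this]
  ring

theorem somborExcess_two_three : somborExcess 2 3 = √13 - 5 / 2 * √2 := by
  rw [somborExcess, show (2 : ℝ) ^ 2 + 3 ^ 2 = 13 by norm_num]
  ring

theorem somborExcess_two_three_pos : 0 < somborExcess 2 3 := by
  rw [somborExcess_two_three]
  have h2 : √2 * √2 = 2 := Real.mul_self_sqrt (by norm_num)
  have : 5 / 2 * √2 < √13 := by
    apply Real.lt_sqrt_of_sq_lt
    nlinarith
  linarith

theorem two_mul_somborExcess_two_three_lt {a b : ℕ} (ha : 0 < a) (hb : 0 < b)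
    (h2 : a ≠ 2) (h3 : a ≠ 3) : 2 * somborExcess 2 3 < somborExcess a b := by
  refine lt_of_lt_of_le ?_ (somborExcess_ge (Nat.cast_pos.2 ha) (Nat.cast_pos.2 hb))
  have hqa := half_le_natCast_sub_mul_sub_div ha h2 h3
  have hqb := natCast_sub_mul_sub_div_nonneg b
  have hs : 0 < √2 := by positivity
  have hsq : √2 * √2 = 2 := Real.mul_self_sqrt (by norm_num)
  have h13 : √13 < 21 / 8 * √2 := by
    rw [Real.sqrt_lt' (by positivity)]
    nlinarith
  rw [somborExcess_two_three]
  nlinarith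

/-- `somborExcess` of the degrees of the end vertices of an edge. -/
noncomputable def edgeExcess (G : SimpleGraph V) (e : Sym2 V) : ℝ :=
  Sym2.lift ⟨fun u v => somborExcess (G.degree u) (G.degree v),
    fun _ _ => somborExcess_comm _ _⟩ e

theorem somborIndex_eq_add_sum_edgeExcess (G : SimpleGraph V) (hG : ∀ v, 0 < G.degree v) :
    somborIndex G = √2 * (5 * G.edgeFinset.card - 3 * Fintype.card V) +
      ∑ e ∈ G.edgeFinset, G.edgeExcess e := by
  have hφ : √2 * (5 * G.edgeFinset.card - 3 * Fintype.card V) =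
      ∑ v, (G.degree v : ℝ) * (√2 * (5 / 2 - 3 / G.degree v)) := by
    have h : ∀ v ∈ Finset.univ, (G.degree v : ℝ) * (√2 * (5 / 2 - 3 / G.degree v)) =
        √2 * (5 / 2) * G.degree v - √2 * 3 := by
      intro v _
      have : (G.degree v : ℝ) ≠ 0 := by exact_mod_cast (hG v).ne'
      field_simp
    rw [Finset.sum_congr rfl h, Finset.sum_sub_distrib, ← Finset.mul_sum, ← Nat.cast_sum,
      G.sum_degrees_eq_twice_card_edges]
    simp
    ring
  rw [hφ, ← sum_edgeFinset_lift_add, ← Finset.sum_add_distrib, somborIndex, vdbTI]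
  refine Finset.sum_congr rfl fun e _ => ?_
  induction e using Sym2.ind with
  | _ u v =>
    simp only [Sym2.lift_mk, edgeExcess, somborExcess]
    rw [add_comm ((G.degree v : ℝ) ^ 2)]
    ring

theorem edgeExcess_nonneg (G : SimpleGraph V) (hG : ∀ v, 0 < G.degree v) (e : Sym2 V) :
    0 ≤ G.edgeExcess e := by
  induction e using Sym2.ind with
  | _ u v => exact somborExcess_nonneg (hG u) (hG v)

theorem degree_eq_two_or_three_of_sum_edgeExcess_le (G : SimpleGraph V)
    (hG : ∀ v, 0 < G.degree v)
    (h : ∑ e ∈ G.edgeFinset, G.edgeExcess e ≤ 2 * somborExcess 2 3) (v : V) :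
    G.degree v = 2 ∨ G.degree v = 3 := by
  by_contra! hv
  obtain ⟨w, hw⟩ := (G.degree_pos_iff_exists_adj v).1 (hG v)
  have he : s(v, w) ∈ G.edgeFinset := by simpa using hw
  have h1 := Finset.single_le_sum (fun e _ => G.edgeExcess_nonneg hG e) he
  have h2 : 2 * somborExcess 2 3 < G.edgeExcess s(v, w) :=
    two_mul_somborExcess_two_three_lt (hG v) (hG w) hv.1 hv.2
  linarith

theorem sum_edgeExcess_eq (G : SimpleGraph V) (hG : ∀ v, G.degree v = 2 ∨ G.degree v = 3) :
    ∑ e ∈ G.edgeFinset, G.edgeExcess e = mDeg G 2 3 * somborExcess 2 3 := by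
  rw [mDeg, ← nsmul_eq_mul, ← Finset.sum_const, Finset.sum_filter]
  refine Finset.sum_congr rfl fun e _ => ?_
  induction e using Sym2.ind with
  | _ u v =>
    simp only [edgeExcess, Sym2.lift_mk]
    rcases hG u with hu | hu <;> rcases hG v with hv | hv <;>
      simp [hu, hv, somborExcess_two_two, somborExcess_three_three, somborExcess_comm 3 2]

theorem mDeg_two_three_add (G : SimpleGraph V) (hG : ∀ v, G.degree v = 2 ∨ G.degree v = 3) :
    mDeg G 2 3 + 2 * mDeg G 3 3 = 3 * (Finset.univ.filter fun v => G.degree v = 3).card := by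
  have h := G.sum_edgeFinset_lift_add fun v => if G.degree v = 3 then 1 else 0
  have h1 : ∑ v, (G.degree v : ℝ) * (if G.degree v = 3 then 1 else 0) =
      3 * (Finset.univ.filter fun v => G.degree v = 3).card := by
    rw [Finset.card_filter, Nat.cast_sum, Finset.mul_sum]
    refine Finset.sum_congr rfl fun v _ => ?_
    split_ifs with hv <;> simp [hv]
  have h2 : ∑ e ∈ G.edgeFinset, Sym2.lift ⟨fun u v => (if G.degree u = 3 then (1 : ℝ) else 0) +
      (if G.degree v = 3 then 1 else 0), fun _ _ => add_comm _ _⟩ e =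
      mDeg G 2 3 + 2 * mDeg G 3 3 := by
    rw [mDeg, mDeg, Finset.card_filter, Finset.card_filter, Nat.cast_sum, Nat.cast_sum,
      Finset.mul_sum, ← Finset.sum_add_distrib]
    refine Finset.sum_congr rfl fun e _ => ?_
    induction e using Sym2.ind with
    | _ u v =>
      simp only [Sym2.lift_mk]
      rcases hG u with hu | hu <;> rcases hG v with hv | hv <;> norm_num [hu, hv]
  rw [h1, h2] at h
  exact_mod_cast h

theorem mDeg_add_add (G : SimpleGraph V) (hG : ∀ v, G.degree v = 2 ∨ G.degree v = 3) :
    mDeg G 2 2 + mDeg G 2 3 + mDeg G 3 3 = G.edgeFinset.card := by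
  rw [mDeg, mDeg, mDeg, Finset.card_filter, Finset.card_filter, Finset.card_filter,
    ← Finset.sum_add_distrib, ← Finset.sum_add_distrib, Finset.card_eq_sum_ones]
  refine Finset.sum_congr rfl fun e _ => ?_
  induction e using Sym2.ind with
  | _ u v =>
    simp only [Sym2.lift_mk]
    rcases hG u with hu | hu <;> rcases hG v with hv | hv <;> norm_num [hu, hv]

theorem two_mul_card_add_card_filter_degree_eq_three (G : SimpleGraph V)
    (hG : ∀ v, G.degree v = 2 ∨ G.degree v = 3) :
    2 * Fintype.card V + (Finset.univ.filter fun v => G.degree v = 3).card =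
      2 * G.edgeFinset.card := by
  rw [← G.sum_degrees_eq_twice_card_edges, Finset.card_filter, ← Finset.card_univ,
    Finset.card_eq_sum_ones, Finset.mul_sum, ← Finset.sum_add_distrib]
  refine Finset.sum_congr rfl fun v _ => ?_
  rcases hG v with hv | hv <;> simp [hv]

theorem mDeg_two_three_pos (G : SimpleGraph V) (hc : G.Connected)
    (hG : ∀ v, G.degree v = 2 ∨ G.degree v = 3)
    {x y : V} (hx : G.degree x = 2) (hy : G.degree y = 3) : 0 < mDeg G 2 3 := by
  obtain ⟨w⟩ := hc.preconnected x y
  obtain ⟨d, -, h1, h2⟩ := w.exists_boundary_dart {v | G.degree v = 2} hx (by simp [hy])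
  refine Finset.card_pos.2 ⟨s(d.fst, d.snd), ?_⟩
  simp only [Finset.mem_filter, mem_edgeFinset, mem_edgeSet, Sym2.lift_mk]
  exact ⟨d.adj, Or.inl ⟨h1, (hG _).resolve_left h2⟩⟩

/-- The cycle `0, 1, …, n - 1` together with the chords joining `i` to `i + p` for `i < p`. -/
def chordedCycle (n p : ℕ) : SimpleGraph (Fin n) :=
  fromRel fun u v => (u : ℕ) + 1 = v ∨ ((v : ℕ) = 0 ∧ (u : ℕ) + 1 = n) ∨
    ((u : ℕ) + p = v ∧ (v : ℕ) < 2 * p)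

theorem chordedCycle_adj {n p : ℕ} {u v : Fin n} : (chordedCycle n p).Adj u v ↔ u ≠ v ∧
    (((u : ℕ) + 1 = v ∨ ((v : ℕ) = 0 ∧ (u : ℕ) + 1 = n) ∨ ((u : ℕ) + p = v ∧ (v : ℕ) < 2 * p)) ∨
      ((v : ℕ) + 1 = u ∨ ((u : ℕ) = 0 ∧ (v : ℕ) + 1 = n) ∨
        ((v : ℕ) + p = u ∧ (u : ℕ) < 2 * p))) :=
  fromRel_adj _ _ _

theorem chordedCycle_connected {n p : ℕ} (hn : 0 < n) : (chordedCycle n p).Connected := by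
  have h : ∀ i (hi : i < n), (chordedCycle n p).Reachable ⟨0, hn⟩ ⟨i, hi⟩ := by
    intro i
    induction i with
    | zero => exact fun _ => Reachable.refl _
    | succ i ih =>
      intro hi
      refine (ih (by omega)).trans (Adj.reachable ?_)
      simp [chordedCycle]
  have : Nonempty (Fin n) := ⟨⟨0, hn⟩⟩
  exact ⟨fun u v => (h u u.2).symm.trans (h v v.2)⟩

theorem chordedCycle_degree {n p : ℕ} (hp : 2 ≤ p) (hn : 2 * p < n) (v : Fin n) :
    (chordedCycle n p).degree v = if (v : ℕ) < 2 * p then 3 else 2 := by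
  let s : Fin n := if h : (v : ℕ) + 1 < n then ⟨v + 1, h⟩ else ⟨0, by omega⟩
  let t : Fin n := if (v : ℕ) = 0 then ⟨n - 1, by omega⟩ else ⟨v - 1, by omega⟩
  have hs : (s : ℕ) = if (v : ℕ) + 1 < n then (v : ℕ) + 1 else 0 := by
    simp only [s]; split_ifs <;> rfl
  have ht : (t : ℕ) = if (v : ℕ) = 0 then n - 1 else (v : ℕ) - 1 := by
    simp only [t]; split_ifs <;> rfl
  have hv := v.2
  rw [← card_neighborFinset_eq_degree]
  by_cases h : (v : ℕ) < 2 * p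
  · let c : Fin n := if h : (v : ℕ) < p then ⟨v + p, by omega⟩ else ⟨v - p, by omega⟩
    have hc : (c : ℕ) = if (v : ℕ) < p then (v : ℕ) + p else v - p := by
      simp only [c]; split_ifs <;> rfl
    rw [if_pos h, Finset.card_eq_three]
    refine ⟨s, t, c, ?_, ?_, ?_, ?_⟩
    · rw [Ne, Fin.ext_iff, hs, ht]; split_ifs <;> omega
    · rw [Ne, Fin.ext_iff, hs, hc]; split_ifs <;> omega
    · rw [Ne, Fin.ext_iff, ht, hc]; split_ifs <;> omega
    · ext w
      have hw := w.2
      simp only [mem_neighborFinset, chordedCycle_adj, Finset.mem_insert,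
        Finset.mem_singleton, Fin.ext_iff, Ne, hs, ht, hc]
      split_ifs <;> omega
  · rw [if_neg h, Finset.card_eq_two]
    refine ⟨s, t, ?_, ?_⟩
    · rw [Ne, Fin.ext_iff, hs, ht]; split_ifs <;> omega
    · ext w
      have hw := w.2
      simp only [mem_neighborFinset, chordedCycle_adj, Finset.mem_insert,
        Finset.mem_singleton, Fin.ext_iff, Ne, hs, ht]
      split_ifs <;> omega

theorem chordedCycle_degree_eq_two_or_three {n p : ℕ} (hp : 2 ≤ p) (hn : 2 * p < n) (v : Fin n) :
    (chordedCycle n p).degree v = 2 ∨ (chordedCycle n p).degree v = 3 := by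
  rw [chordedCycle_degree hp hn]
  split_ifs <;> simp

theorem card_edgeFinset_chordedCycle {n p : ℕ} (hp : 2 ≤ p) (hn : 2 * p < n) :
    (chordedCycle n p).edgeFinset.card = n + p := by
  have h := two_mul_card_add_card_filter_degree_eq_three (chordedCycle n p)
    (chordedCycle_degree_eq_two_or_three hp hn)
  have hc : (Finset.univ.filter fun v => (chordedCycle n p).degree v = 3).card = 2 * p := by
    have : (Finset.univ.filter fun v => (chordedCycle n p).degree v = 3) =
        Finset.univ.filter fun v : Fin n => (v : ℕ) < 2 * p := by
      ext v
      simp only [Finset.mem_filter, Finset.mem_univ, true_and, chordedCycle_degree hp hn]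
      split_ifs with h <;> simp [h]
    rw [this, Fin.card_filter_val_lt]
    omega
  rw [hc, Fintype.card_fin] at h
  omega

theorem mDeg_two_three_chordedCycle_le {n p : ℕ} (hp : 2 ≤ p) (hn : 2 * p < n) :
    mDeg (chordedCycle n p) 2 3 ≤ 2 := by
  refine (Finset.card_le_card (t := {s(⟨n - 1, by omega⟩, ⟨0, by omega⟩),
    s(⟨2 * p, hn⟩, ⟨2 * p - 1, by omega⟩)}) ?_).trans Finset.card_le_two
  intro e
  induction e using Sym2.ind with
  | _ u v =>
    have hu := u.2
    have hv := v.2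
    simp only [Finset.mem_filter, mem_edgeFinset, mem_edgeSet, Sym2.lift_mk,
      chordedCycle_degree hp hn, chordedCycle_adj, Finset.mem_insert,
      Finset.mem_singleton, Sym2.eq_iff, Fin.ext_iff, Ne]
    split_ifs <;> omega

end SimpleGraph

open SimpleGraph

theorem minimal_sombor_kcyclic (n k : ℕ) (hk : 3 ≤ k) (hn : 5 * (k - 1) ≤ n)
    (G : SimpleGraph (Fin n)) (hconn : G.Connected) (hm : G.edgeFinset.card = n + k - 1)
    (hmin : ∀ H : SimpleGraph (Fin n), H.Connected → H.edgeFinset.card = n + k - 1 →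
      somborIndex G ≤ somborIndex H) :
    (∀ v : Fin n, G.degree v = 2 ∨ G.degree v = 3) ∧
    (∃ v : Fin n, G.degree v = 2) ∧ (∃ v : Fin n, G.degree v = 3) ∧
    mDeg G 2 3 = 2 ∧ mDeg G 2 2 = n - 2 * k + 1 ∧ mDeg G 3 3 = 3 * k - 4 ∧
    somborIndex G = (2 * (n : ℝ) + 5 * (k : ℝ) - 10) * Real.sqrt 2 + 2 * Real.sqrt 13 := by
  obtain ⟨p, rfl⟩ : ∃ p, k = p + 1 := ⟨k - 1, by omega⟩
  have hp : 2 ≤ p := by omega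
  have hpn : 2 * p < n := by omega
  have : Nontrivial (Fin n) := Fin.nontrivial_iff_two_le.2 (by omega)
  have hpos : ∀ v, 0 < G.degree v := fun v => hconn.preconnected.degree_pos_of_nontrivial v
  have hHdeg := chordedCycle_degree_eq_two_or_three hp hpn
  have hHcard := card_edgeFinset_chordedCycle hp hpn
  have hle := hmin (chordedCycle n p) (chordedCycle_connected (by omega)) (by omega)
  have hGcard : G.edgeFinset.card = n + p := by omega
  have hGsum := somborIndex_eq_add_sum_edgeExcess G hpos
  have hHsum := somborIndex_eq_add_sum_edgeExcess (chordedCycle n p)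
    fun v => by rcases hHdeg v with h | h <;> omega
  rw [hGcard] at hGsum
  rw [hHcard, sum_edgeExcess_eq _ hHdeg] at hHsum
  have hc := somborExcess_two_three_pos
  have hH2 : (mDeg (chordedCycle n p) 2 3 : ℝ) ≤ 2 := by
    exact_mod_cast mDeg_two_three_chordedCycle_le hp hpn
  have hexc : ∑ e ∈ G.edgeFinset, G.edgeExcess e ≤ 2 * somborExcess 2 3 := by
    have := mul_le_mul_of_nonneg_right hH2 hc.le
    linarith
  have hdeg := degree_eq_two_or_three_of_sum_edgeExcess_le G hpos hexc
  have hn3 := two_mul_card_add_card_filter_degree_eq_three G hdeg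
  have h33 := mDeg_two_three_add G hdeg
  have htot := mDeg_add_add G hdeg
  rw [hGcard, Fintype.card_fin] at hn3
  rw [hGcard] at htot
  rw [sum_edgeExcess_eq G hdeg] at hexc hGsum
  have h23 : mDeg G 2 3 ≤ 2 := by exact_mod_cast le_of_mul_le_mul_right hexc hc
  have hthree : ∃ v, G.degree v = 3 := by
    obtain ⟨v, hv⟩ := Finset.card_pos.1
      (show 0 < (Finset.univ.filter fun v => G.degree v = 3).card by omega)
    exact ⟨v, (Finset.mem_filter.1 hv).2⟩
  have htwo : ∃ v, G.degree v = 2 := by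
    by_contra! h
    have : (Finset.univ.filter fun v => G.degree v = 3) = Finset.univ :=
      Finset.filter_true_of_mem fun v _ => (hdeg v).resolve_left (h v)
    rw [this, Finset.card_univ, Fintype.card_fin] at hn3
    omega
  obtain ⟨x, hx⟩ := htwo
  obtain ⟨y, hy⟩ := hthree
  have h23pos := mDeg_two_three_pos G hconn hdeg hx hy
  have h23eq : mDeg G 2 3 = 2 := by omega
  refine ⟨hdeg, ⟨x, hx⟩, ⟨y, hy⟩, h23eq, by omega, by omega, ?_⟩
  rw [hGsum, h23eq, somborExcess_two_three, Fintype.card_fin]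
  push_cast
  ring
end

section
/- Let α ∈ [1/2, 1) and let a, b be real numbers with a > b + 1 ≥ 2. Then a·[(2a²)^α − ((a−1)² + a²)^α] − b·[((b+1)² + b²)^α − (2b²)^α] > 0. In particular, the function I(x,y) = (x² + y²)^α satisfies H(a,b) > 0 for all a > b + 1 ≥ 2, where H(a,b) = a[I(a,a) − I(a−1,a)] − b[I(b+1,b) − I(b,b)]. -/
/-- A concave power lies below its tangent line. -/
theorem rpow_le_tangent {α x y : ℝ} (hα0 : 0 ≤ α) (hα1 : α ≤ 1) (hx : 0 < x) (hy : 0 ≤ y) :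
    y ^ α ≤ x ^ α + α * x ^ (α - 1) * (y - x) := by
  have hs : -1 ≤ (y - x) / x := by
    rw [le_div_iff₀ hx]
    linarith
  have bernoulli := rpow_one_add_le_one_add_mul_self hs hα0 hα1
  have hyx : y = x * (1 + (y - x) / x) := by
    field_simp
    ring
  calc y ^ α = x ^ α * (1 + (y - x) / x) ^ α := by
        rw [← Real.mul_rpow hx.le (by linarith), ← hyx]
    _ ≤ x ^ α * (1 + α * ((y - x) / x)) := by gcongr
    _ = x ^ α + α * x ^ (α - 1) * (y - x) := by
        rw [Real.rpow_sub_one hx.ne']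
        field_simp

theorem mul_two_mul_sq_rpow_sub_one {x : ℝ} (α : ℝ) (hx : 0 < x) :
    x * (2 * x ^ 2) ^ (α - 1) = 2 ^ (α - 1) * x ^ (2 * α - 1) := by
  have hexp : 2 * α - 1 = 2 * (α - 1) + 1 := by ring
  rw [Real.mul_rpow zero_le_two (sq_nonneg x), hexp, Real.rpow_add_one hx.ne',
    Real.rpow_mul hx.le, Real.rpow_two]
  ring

theorem genSombor_H_pos (α : ℝ) (hα0 : 1 / 2 ≤ α) (hα1 : α < 1)
    (a b : ℝ) (hb : 2 ≤ b + 1) (hab : b + 1 < a) :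
    0 < a * ((2 * a ^ 2) ^ α - ((a - 1) ^ 2 + a ^ 2) ^ α)
      - b * (((b + 1) ^ 2 + b ^ 2) ^ α - (2 * b ^ 2) ^ α) := by
  have hα : 0 < α := by linarith
  have hb0 : 0 < b := by linarith
  have ha0 : 0 < a := by linarith
  have hA := rpow_le_tangent hα.le hα1.le (x := 2 * a ^ 2) (y := (a - 1) ^ 2 + a ^ 2)
    (by positivity) (by positivity)
  have hB := rpow_le_tangent hα.le hα1.le (x := 2 * b ^ 2) (y := (b + 1) ^ 2 + b ^ 2)
    (by positivity) (by positivity)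
  have hmono : b * (2 * b ^ 2) ^ (α - 1) ≤ a * (2 * a ^ 2) ^ (α - 1) := by
    rw [mul_two_mul_sq_rpow_sub_one α hb0, mul_two_mul_sq_rpow_sub_one α ha0]
    gcongr <;> linarith
  have hpos : 0 < b * (2 * b ^ 2) ^ (α - 1) := by positivity
  have hslope : α * (b * (2 * b ^ 2) ^ (α - 1) * (2 * b + 1))
      < α * (a * (2 * a ^ 2) ^ (α - 1) * (2 * a - 1)) :=
    mul_lt_mul_of_pos_left
      (mul_lt_mul' hmono (by linarith) (by positivity) (hpos.trans_le hmono)) hα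
  have hA' := mul_le_mul_of_nonneg_left hA ha0.le
  have hB' := mul_le_mul_of_nonneg_left hB hb0.le
  linarith
end

section
/- Let α ∈ [1/2, 1), k ≥ 3 and n ≥ 5(k−1). If G is a graph achieving the least value of the general Sombor index SO_α over 𝒢_{n,k}, then G is a bidegreed graph with degree set {2,3}, m_{2,3}(G) = 2, m_{2,2}(G) = n − 2k + 1, m_{3,3}(G) = 3k − 4, and SO_α(G) = 2·13^α + (n − 2k + 1)·8^α + (3k − 4)·18^α. -/
attribute [local instance] Classical.propDecidable

/-- The general Sombor index `SO_α(G) = Σ_{uv ∈ E(G)} (d_u² + d_v²)^α`. -/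
noncomputable def genSomborIndex {V : Type*} [Fintype V] (α : ℝ) (G : SimpleGraph V) : ℝ :=
  vdbTI (fun x y => (x ^ 2 + y ^ 2) ^ α) G

section EdgeSums

variable {V : Type*} [Fintype V] (G : SimpleGraph V)

theorem vdbTI_congr {I J : ℝ → ℝ → ℝ}
    (h : ∀ u v, G.Adj u v → I (G.degree u) (G.degree v) = J (G.degree u) (G.degree v)) :
    vdbTI I G = vdbTI J G := by
  refine Finset.sum_congr rfl fun e he => ?_
  induction e with
  | h u v =>
    have huv : G.Adj u v := by simpa using he
    simp only [Sym2.lift_mk, h u v huv, h v u huv.symm]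

theorem vdbTI_add (I J : ℝ → ℝ → ℝ) :
    vdbTI (fun x y => I x y + J x y) G = vdbTI I G + vdbTI J G := by
  unfold vdbTI
  rw [← Finset.sum_add_distrib]
  refine Finset.sum_congr rfl fun e _ => ?_
  induction e with
  | h u v => simp only [Sym2.lift_mk]; ring

theorem vdbTI_mul_left (c : ℝ) (I : ℝ → ℝ → ℝ) :
    vdbTI (fun x y => c * I x y) G = c * vdbTI I G := by
  unfold vdbTI
  rw [Finset.mul_sum]
  refine Finset.sum_congr rfl fun e _ => ?_
  induction e with
  | h u v => simp only [Sym2.lift_mk]; ring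

theorem vdbTI_one : vdbTI (fun _ _ => 1) G = G.edgeFinset.card := by
  unfold vdbTI
  rw [Finset.card_eq_sum_ones, Nat.cast_sum]
  refine Finset.sum_congr rfl fun e _ => ?_
  induction e with
  | h u v => simp

theorem vdbTI_separable (g : ℝ → ℝ) :
    vdbTI (fun x y => g x + g y) G = ∑ v, (G.degree v : ℝ) * g (G.degree v) := by
  have hfst : ∑ d : G.Dart, g (G.degree d.fst) = ∑ v, (G.degree v : ℝ) * g (G.degree v) := by
    rw [← Finset.sum_fiberwise (s := Finset.univ) (g := fun d : G.Dart => d.fst)]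
    refine Finset.sum_congr rfl fun v _ => ?_
    rw [← G.dart_fst_fiber_card_eq_degree v, ← nsmul_eq_mul]
    refine Finset.sum_eq_card_nsmul fun d hd => ?_
    rw [(Finset.mem_filter.1 hd).2, G.dart_fst_fiber_card_eq_degree]
  have hsnd : ∑ d : G.Dart, g (G.degree d.snd) = ∑ d : G.Dart, g (G.degree d.fst) :=
    Fintype.sum_equiv (Equiv.ofBijective _ SimpleGraph.Dart.symm_involutive.bijective) _ _
      fun _ => rfl
  have hdart : ∀ F : Sym2 V → ℝ, ∑ d : G.Dart, F d.edge = 2 * ∑ e ∈ G.edgeFinset, F e := by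
    intro F
    rw [← Finset.sum_fiberwise_of_maps_to (s := Finset.univ) (t := G.edgeFinset)
      (g := fun d : G.Dart => d.edge) (by simp), Finset.mul_sum]
    refine Finset.sum_congr rfl fun e he => ?_
    have hcard := G.dart_edge_fiber_card e (by simpa using he)
    rw [Finset.sum_congr rfl fun d hd => by rw [(Finset.mem_filter.1 hd).2],
      Finset.sum_const, nsmul_eq_mul]
    congr 1
    exact_mod_cast by convert hcard
  have key := hdart (Sym2.lift
    ⟨fun u v => ((g (G.degree u) + g (G.degree v)) + (g (G.degree v) + g (G.degree u))) / 2,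
     fun _ _ => by ring⟩)
  have hsum : ∑ d : G.Dart, (Sym2.lift
    ⟨fun u v => ((g (G.degree u) + g (G.degree v)) + (g (G.degree v) + g (G.degree u))) / 2,
     fun _ _ => by ring⟩ d.edge : ℝ) =
      ∑ d : G.Dart, g (G.degree d.fst) + ∑ d : G.Dart, g (G.degree d.snd) := by
    rw [← Finset.sum_add_distrib]
    refine Finset.sum_congr rfl fun d _ => ?_
    simp only [SimpleGraph.Dart.edge, Sym2.lift_mk]
    ring
  unfold vdbTI
  rw [hsum, hsnd, hfst] at key
  linarith

theorem mDeg_eq_vdbTI (i j : ℕ) :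
    (mDeg G i j : ℝ) =
      vdbTI (fun x y => if (x = i ∧ y = j) ∨ (y = i ∧ x = j) then 1 else 0) G := by
  unfold mDeg vdbTI
  rw [Finset.card_filter, Nat.cast_sum]
  refine Finset.sum_congr rfl fun e _ => ?_
  induction e with
  | h u v =>
    simp only [Sym2.lift_mk, Nat.cast_inj]
    by_cases h : (G.degree u = i ∧ G.degree v = j) ∨ (G.degree v = i ∧ G.degree u = j)
    · rw [if_pos h.symm, if_pos h]
      exact (congrArg Nat.cast (if_pos h)).trans (by norm_num)
    · rw [if_neg (mt Or.symm h), if_neg h]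
      exact (congrArg Nat.cast (if_neg h)).trans (by norm_num)

theorem le_vdbTI_of_adj {I : ℝ → ℝ → ℝ} (hsymm : ∀ x y, I x y = I y x)
    (h0 : ∀ u v, G.Adj u v → 0 ≤ I (G.degree u) (G.degree v)) {u v : V} (huv : G.Adj u v) :
    I (G.degree u) (G.degree v) ≤ vdbTI I G := by
  have hle := Finset.single_le_sum (s := G.edgeFinset)
    (f := Sym2.lift
      ⟨fun u v => (I (G.degree u) (G.degree v) + I (G.degree v) (G.degree u)) / 2,
       fun _ _ => by ring⟩) (fun e he => by
        induction e with
        | h a b =>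
          have hab : G.Adj a b := by simpa using he
          have := h0 a b hab
          have := h0 b a hab.symm
          simp only [Sym2.lift_mk]
          linarith) (a := s(u, v)) (by simpa using huv)
  simp only [Sym2.lift_mk] at hle
  rw [hsymm (G.degree v) (G.degree u)] at hle
  unfold vdbTI
  linarith

/-- In a graph all of whose degrees are `2` or `3`, the numbers `m_{2,2}`, `m_{2,3}`, `m_{3,3}` are
determined by `m_{2,3}`, the order and the size; moreover `m_{2,3}` is even. -/
theorem mDeg_of_bidegreed (hdeg : ∀ v, G.degree v = 2 ∨ G.degree v = 3) :
    ∃ n₂ n₃ : ℕ, n₂ + n₃ = Fintype.card V ∧ 2 * mDeg G 2 2 + mDeg G 2 3 = 2 * n₂ ∧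
      2 * mDeg G 3 3 + mDeg G 2 3 = 3 * n₃ ∧
      mDeg G 2 2 + mDeg G 2 3 + mDeg G 3 3 = G.edgeFinset.card ∧
      n₂ = (Finset.univ.filter fun v => G.degree v = 2).card ∧
      n₃ = (Finset.univ.filter fun v => G.degree v = 3).card := by
  refine ⟨(Finset.univ.filter fun v => G.degree v = 2).card,
    (Finset.univ.filter fun v => G.degree v = 3).card, ?_, ?_, ?_, ?_, rfl, rfl⟩
  · rw [← Finset.card_union_of_disjoint, ← Finset.filter_or, Finset.filter_true_of_mem
      fun v _ => hdeg v, Finset.card_univ]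
    refine Finset.disjoint_filter.2 fun v _ h => by omega
  · have h := vdbTI_separable G (fun x => if x = 2 then 1 else 0)
    have hR : ∑ v, (G.degree v : ℝ) * (if (G.degree v : ℝ) = 2 then 1 else 0) =
        2 * ((Finset.univ.filter fun v => G.degree v = 2).card : ℝ) := by
      rw [Finset.card_filter, Nat.cast_sum, Finset.mul_sum]
      refine Finset.sum_congr rfl fun v _ => ?_
      rcases hdeg v with hv | hv <;> norm_num [hv]
    rw [hR] at h
    have : (2 * mDeg G 2 2 + mDeg G 2 3 : ℝ) =
        2 * (Finset.univ.filter fun v => G.degree v = 2).card := by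
      rw [← h, mDeg_eq_vdbTI, mDeg_eq_vdbTI, ← vdbTI_mul_left, ← vdbTI_add]
      refine vdbTI_congr G fun u v _ => ?_
      rcases hdeg u with hu | hu <;> rcases hdeg v with hv | hv <;> norm_num [hu, hv]
    exact_mod_cast this
  · have h := vdbTI_separable G (fun x => if x = 3 then 1 else 0)
    have hR : ∑ v, (G.degree v : ℝ) * (if (G.degree v : ℝ) = 3 then 1 else 0) =
        3 * ((Finset.univ.filter fun v => G.degree v = 3).card : ℝ) := by
      rw [Finset.card_filter, Nat.cast_sum, Finset.mul_sum]
      refine Finset.sum_congr rfl fun v _ => ?_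
      rcases hdeg v with hv | hv <;> norm_num [hv]
    rw [hR] at h
    have : (2 * mDeg G 3 3 + mDeg G 2 3 : ℝ) =
        3 * (Finset.univ.filter fun v => G.degree v = 3).card := by
      rw [← h, mDeg_eq_vdbTI, mDeg_eq_vdbTI, ← vdbTI_mul_left, ← vdbTI_add]
      refine vdbTI_congr G fun u v _ => ?_
      rcases hdeg u with hu | hu <;> rcases hdeg v with hv | hv <;> norm_num [hu, hv]
    exact_mod_cast this
  · have : (mDeg G 2 2 + mDeg G 2 3 + mDeg G 3 3 : ℝ) = G.edgeFinset.card := by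
      rw [← vdbTI_one, mDeg_eq_vdbTI, mDeg_eq_vdbTI, mDeg_eq_vdbTI, ← vdbTI_add, ← vdbTI_add]
      refine vdbTI_congr G fun u v _ => ?_
      rcases hdeg u with hu | hu <;> rcases hdeg v with hv | hv <;> norm_num [hu, hv]
    exact_mod_cast this

theorem mDeg_two_three_pos (hconn : G.Connected) (hdeg : ∀ v, G.degree v = 2 ∨ G.degree v = 3)
    {u v : V} (hu : G.degree u = 2) (hv : G.degree v = 3) : 0 < mDeg G 2 3 := by
  obtain ⟨p⟩ := hconn.preconnected u v
  obtain ⟨d, -, h1, h2⟩ := p.exists_boundary_dart {w | G.degree w = 2} hu (by simp [hv])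
  refine Finset.card_pos.2 ⟨s(d.fst, d.snd), Finset.mem_filter.2 ⟨by simp, ?_⟩⟩
  exact Or.inl ⟨h1, (hdeg d.snd).resolve_left h2⟩

end EdgeSums

section EdgeExcess

/-- The amount by which the weight `(x² + y²)^α` exceeds the function affine in `1/x + 1/y` that
agrees with it at `(2, 2)` and `(3, 3)`. -/
noncomputable def somborExcess (α x y : ℝ) : ℝ :=
  (x ^ 2 + y ^ 2) ^ α - 8 ^ α - 3 * (18 ^ α - 8 ^ α) * (1 - (1 / x + 1 / y))

theorem somborExcess_comm (α x y : ℝ) : somborExcess α x y = somborExcess α y x := by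
  unfold somborExcess
  rw [add_comm (x ^ 2), add_comm (1 / x)]

theorem somborExcess_two_two (α : ℝ) : somborExcess α 2 2 = 0 := by
  norm_num [somborExcess]

theorem somborExcess_three_three (α : ℝ) : somborExcess α 3 3 = 0 := by
  norm_num [somborExcess]
  ring

theorem somborExcess_two_three (α : ℝ) :
    somborExcess α 2 3 = 13 ^ α - (8 ^ α + 18 ^ α) / 2 := by
  norm_num [somborExcess]
  ring

theorem somborExcess_two_three_pos {α : ℝ} (h0 : 0 < α) (h1 : α < 1) :
    0 < somborExcess α 2 3 := by
  obtain ⟨-, hc⟩ := Real.strictConcaveOn_rpow h0 h1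
  have h := hc (x := 8) (y := 18) (by norm_num) (by norm_num)
    (by norm_num) (a := 1 / 2) (b := 1 / 2) (by norm_num) (by norm_num) (by norm_num)
  norm_num at h
  rw [somborExcess_two_three]
  linarith

theorem rpow_two_mul_sq {z α : ℝ} (hz : 0 ≤ z) : (2 * z ^ 2) ^ α = 2 ^ α * z ^ (2 * α) := by
  rw [Real.mul_rpow (by norm_num) (by positivity), ← Real.rpow_natCast, ← Real.rpow_mul hz]
  norm_num

theorem rpow_line_le {γ z : ℝ} (hγ : 1 ≤ γ) (hz : 0 ≤ z) (hz' : z ≤ 2 ∨ 3 ≤ z) :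
    2 ^ γ + (z - 2) * (3 ^ γ - 2 ^ γ) ≤ z ^ γ := by
  obtain ⟨-, hc⟩ := convexOn_rpow hγ
  rcases hz' with h | h
  · have h3 : 0 < 3 - z := by linarith
    have := hc (x := z) (y := 3) hz (by norm_num) (a := 1 / (3 - z)) (b := (2 - z) / (3 - z))
      (by positivity) (div_nonneg (by linarith) h3.le) (by field_simp; ring)
    simp only [smul_eq_mul] at this
    rw [show 1 / (3 - z) * z + (2 - z) / (3 - z) * 3 = 2 by field_simp; ring] at this
    rw [show 1 / (3 - z) * z ^ γ + (2 - z) / (3 - z) * 3 ^ γ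
      = (z ^ γ + (2 - z) * 3 ^ γ) / (3 - z) by field_simp, le_div_iff₀ h3] at this
    linarith
  · have h3 : 0 < z - 2 := by linarith
    have := hc (x := 2) (y := z) (by norm_num) hz (a := (z - 3) / (z - 2)) (b := 1 / (z - 2))
      (div_nonneg (by linarith) h3.le) (by positivity) (by field_simp; ring)
    simp only [smul_eq_mul] at this
    rw [show (z - 3) / (z - 2) * 2 + 1 / (z - 2) * z = 3 by field_simp; ring] at this
    rw [show (z - 3) / (z - 2) * 2 ^ γ + 1 / (z - 2) * z ^ γ
      = ((z - 3) * 2 ^ γ + z ^ γ) / (z - 2) by field_simp, le_div_iff₀ h3] at this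
    linarith

theorem thirteen_rpow_le {α : ℝ} (h0 : 1 / 2 ≤ α) :
    (13 : ℝ) ^ α ≤ 9 / 20 * 8 ^ α + 11 / 20 * 18 ^ α := by
  obtain ⟨-, hconv⟩ := convexOn_rpow (p := 2 * α) (by linarith)
  have hc := hconv (x := 2) (y := 3) (by norm_num)
    (by norm_num) (a := 9 / 20) (b := 11 / 20) (by norm_num) (by norm_num) (by norm_num)
  norm_num at hc
  have h13 : (13 : ℝ) ^ α ≤ (2 * (51 / 20) ^ 2) ^ α :=
    Real.rpow_le_rpow (by norm_num) (by norm_num) (by linarith)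
  rw [rpow_two_mul_sq (by norm_num)] at h13
  rw [show (8 : ℝ) = 2 * 2 ^ 2 by norm_num, show (18 : ℝ) = 2 * 3 ^ 2 by norm_num,
    rpow_two_mul_sq (by norm_num), rpow_two_mul_sq (by norm_num)]
  have h2 : (0 : ℝ) < 2 ^ α := by positivity
  nlinarith

/-- The discrete function `i ↦ i / 2 + 3 / i` takes its minimum `5/2` at `2` and `3` only. -/
theorem half_add_three_div {i : ℕ} (hi : 1 ≤ i) :
    (5 / 2 : ℝ) ≤ i / 2 + 3 / i ∧ (i ≠ 2 → i ≠ 3 → (11 / 4 : ℝ) ≤ i / 2 + 3 / i) := by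
  have hpos : (0 : ℝ) < i := by exact_mod_cast hi
  rw [show (i : ℝ) / 2 + 3 / i = (i * i + 6) / (2 * i) by field_simp; ring,
    le_div_iff₀ (by positivity), le_div_iff₀ (by positivity)]
  by_cases h4 : 4 ≤ i
  · have : (4 : ℝ) ≤ i := by exact_mod_cast h4
    constructor
    · nlinarith
    · intro _ _; nlinarith
  · have : i = 1 ∨ i = 2 ∨ i = 3 := by omega
    rcases this with rfl | rfl | rfl <;> norm_num

theorem lt_somborExcess {α : ℝ} (h0 : 1 / 2 ≤ α) {i j : ℕ} (hi : 1 ≤ i) (hj : 1 ≤ j)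
    (hij : ¬ ((i = 2 ∨ i = 3) ∧ (j = 2 ∨ j = 3))) :
    2 * somborExcess α 2 3 < somborExcess α i j := by
  have hD : (8 : ℝ) ^ α < 18 ^ α := Real.rpow_lt_rpow (by norm_num) (by norm_num) (by linarith)
  have h13 := thirteen_rpow_le h0
  have hi0 : (0 : ℝ) < i := by exact_mod_cast hi
  have hj0 : (0 : ℝ) < j := by exact_mod_cast hj
  have hh : (21 / 4 : ℝ) ≤ (i / 2 + 3 / i) + (j / 2 + 3 / j) := by
    have hi' := half_add_three_div hi
    have hj' := half_add_three_div hj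
    by_cases h : i = 2 ∨ i = 3
    · have := hj'.2 (by tauto) (by tauto)
      linarith [hi'.1]
    · have := hi'.2 (by tauto) (by tauto)
      linarith [hj'.1]
  have hmean : (2 * (((i : ℝ) + j) / 2) ^ 2) ^ α ≤ ((i : ℝ) ^ 2 + j ^ 2) ^ α :=
    Real.rpow_le_rpow (by positivity) (by nlinarith [sq_nonneg ((i : ℝ) - j)]) (by linarith)
  have e1 : (1 : ℝ) / i = 3 / i / 3 := by ring
  have e2 : (1 : ℝ) / j = 3 / j / 3 := by ring
  rw [somborExcess_two_three]
  unfold somborExcess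
  by_cases h5 : i + j = 5
  · have hp : (1 : ℝ) - (1 / i + 1 / j) ≤ -1 / 4 := by
      have : i = 1 ∧ j = 4 ∨ i = 4 ∧ j = 1 := by omega
      rcases this with ⟨rfl, rfl⟩ | ⟨rfl, rfl⟩ <;> norm_num
    have h8 : (8 : ℝ) ^ α ≤ (2 * (((i : ℝ) + j) / 2) ^ 2) ^ α := by
      have : (i : ℝ) + j = 5 := by exact_mod_cast h5
      rw [this]
      exact Real.rpow_le_rpow (by norm_num) (by norm_num) (by linarith)
    nlinarith
  · have hz : ((i : ℝ) + j) / 2 ≤ 2 ∨ 3 ≤ ((i : ℝ) + j) / 2 := by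
      rcases (by omega : i + j ≤ 4 ∨ 6 ≤ i + j) with h | h
      · left
        have : (i : ℝ) + j ≤ 4 := by exact_mod_cast h
        linarith
      · right
        have : (6 : ℝ) ≤ i + j := by exact_mod_cast h
        linarith
    have hline := rpow_line_le (γ := 2 * α) (by linarith) (by positivity) hz
    have h2 : (0 : ℝ) < 2 ^ α := by positivity
    have hline' := mul_le_mul_of_nonneg_left hline h2.le
    rw [← rpow_two_mul_sq (by positivity)] at hline'
    have h8 : (8 : ℝ) ^ α = 2 ^ α * 2 ^ (2 * α) := by
      rw [← rpow_two_mul_sq (by norm_num)]; norm_num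
    have h18 : (18 : ℝ) ^ α = 2 ^ α * 3 ^ (2 * α) := by
      rw [← rpow_two_mul_sq (by norm_num)]; norm_num
    have hX : (8 : ℝ) ^ α + (((i : ℝ) + j) / 2 - 2) * (18 ^ α - 8 ^ α)
        ≤ ((i : ℝ) ^ 2 + j ^ 2) ^ α := by
      rw [h8, h18]
      linarith
    rw [e1, e2]
    nlinarith [mul_le_mul_of_nonneg_right hh (sub_pos.2 hD).le]

theorem somborExcess_nonneg {α : ℝ} (h0 : 1 / 2 ≤ α) (h1 : α < 1) {i j : ℕ} (hi : 1 ≤ i)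
    (hj : 1 ≤ j) : 0 ≤ somborExcess α i j := by
  have hs := somborExcess_two_three_pos (by linarith) h1
  by_cases h : (i = 2 ∨ i = 3) ∧ (j = 2 ∨ j = 3)
  · rcases h with ⟨rfl | rfl, rfl | rfl⟩
    · exact (somborExcess_two_two α).ge
    · exact hs.le
    · rw [somborExcess_comm]; exact hs.le
    · exact (somborExcess_three_three α).ge
  · linarith [lt_somborExcess h0 hi hj h]

variable {V : Type*} [Fintype V] (G : SimpleGraph V)

theorem genSomborIndex_eq (α : ℝ) (hpos : ∀ v, 1 ≤ G.degree v) :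
    genSomborIndex α G = G.edgeFinset.card * 8 ^ α
      + 3 * (18 ^ α - 8 ^ α) * (G.edgeFinset.card - Fintype.card V)
      + vdbTI (somborExcess α) G := by
  have hV : vdbTI (fun x y => 1 / x + 1 / y) G = Fintype.card V := by
    rw [vdbTI_separable G (fun x => 1 / x), Finset.sum_congr rfl (g := fun _ => (1 : ℝ))]
    · simp
    · intro v _
      have : (G.degree v : ℝ) ≠ 0 := by exact_mod_cast Nat.one_le_iff_ne_zero.1 (hpos v)
      field_simp
  have h1 := vdbTI_one G
  have h : genSomborIndex α G = vdbTI (fun x y =>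
      ((8 ^ α + 3 * (18 ^ α - 8 ^ α)) * 1 + (-(3 * (18 ^ α - 8 ^ α))) * (1 / x + 1 / y))
        + somborExcess α x y) G := by
    refine vdbTI_congr G fun u v _ => ?_
    unfold somborExcess
    ring
  rw [h, vdbTI_add, vdbTI_add, vdbTI_mul_left, vdbTI_mul_left, hV, h1]
  ring

theorem vdbTI_somborExcess_of_bidegreed (α : ℝ)
    (hdeg : ∀ v, G.degree v = 2 ∨ G.degree v = 3) :
    vdbTI (somborExcess α) G = somborExcess α 2 3 * mDeg G 2 3 := by
  rw [mDeg_eq_vdbTI, ← vdbTI_mul_left]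
  refine vdbTI_congr G fun u v _ => ?_
  rcases hdeg u with hu | hu <;> rcases hdeg v with hv | hv <;>
    norm_num [hu, hv, somborExcess_two_two, somborExcess_three_three]
  exact somborExcess_comm α 3 2

end EdgeExcess

section Extremal

/-- The cycle `0, 1, …, n - 1` with the chords `{i, i + r}` for `i < r`. -/
def chordedCycle (n r : ℕ) (hr : 2 ≤ r) (hn : 2 * r + 2 ≤ n) : SimpleGraph (Fin n) where
  Adj u v := (v.1 = u.1 + 1 ∨ u.1 = v.1 + 1) ∨ (u.1 + 1 = n ∧ v.1 = 0 ∨ v.1 + 1 = n ∧ u.1 = 0) ∨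
    (u.1 < r ∧ v.1 = u.1 + r ∨ v.1 < r ∧ u.1 = v.1 + r)
  symm := ⟨fun u v h => by omega⟩
  loopless := ⟨fun u h => by omega⟩

variable {n r : ℕ} (hr : 2 ≤ r) (hn : 2 * r + 2 ≤ n)

theorem chordedCycle_adj (u v : Fin n) : (chordedCycle n r hr hn).Adj u v ↔
    (v.1 = u.1 + 1 ∨ u.1 = v.1 + 1) ∨ (u.1 + 1 = n ∧ v.1 = 0 ∨ v.1 + 1 = n ∧ u.1 = 0) ∨
    (u.1 < r ∧ v.1 = u.1 + r ∨ v.1 < r ∧ u.1 = v.1 + r) := Iff.rfl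

theorem chordedCycle_connected : (chordedCycle n r hr hn).Connected := by
  have h0 : ∀ m (hm : m < n), (chordedCycle n r hr hn).Reachable ⟨0, by omega⟩ ⟨m, hm⟩ := by
    intro m
    induction m with
    | zero => exact fun _ => SimpleGraph.Reachable.refl _
    | succ m ih =>
      intro hm
      refine (ih (by omega)).trans (SimpleGraph.Adj.reachable ?_)
      rw [chordedCycle_adj]
      simp
  have : Nonempty (Fin n) := ⟨⟨0, by omega⟩⟩
  exact ⟨fun u v => (h0 u.1 u.2).symm.trans (h0 v.1 v.2)⟩

theorem chordedCycle_degree (v : Fin n) :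
    (chordedCycle n r hr hn).degree v = if v.1 < 2 * r then 3 else 2 := by
  obtain ⟨v, hv⟩ := v
  have hsucc : (if v + 1 = n then 0 else v + 1) < n := by split_ifs <;> omega
  have hpred : (if v = 0 then n - 1 else v - 1) < n := by split_ifs <;> omega
  have hchord : (if v < r then v + r else v - r) < n := by split_ifs <;> omega
  rw [← SimpleGraph.card_neighborFinset_eq_degree]
  split_ifs with h
  · refine Finset.card_eq_three.2 ⟨⟨_, hsucc⟩, ⟨_, hpred⟩, ⟨_, hchord⟩, ?_, ?_, ?_, ?_⟩
    · rw [Ne, Fin.mk.injEq]; split_ifs <;> omega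
    · rw [Ne, Fin.mk.injEq]; dsimp only at h; split_ifs <;> omega
    · rw [Ne, Fin.mk.injEq]; dsimp only at h; split_ifs <;> omega
    · ext ⟨w, hw⟩
      simp only [SimpleGraph.mem_neighborFinset, chordedCycle_adj, Finset.mem_insert,
        Finset.mem_singleton, Fin.mk.injEq]
      dsimp only at h
      split_ifs <;> omega
  · refine Finset.card_eq_two.2 ⟨⟨_, hsucc⟩, ⟨_, hpred⟩, ?_, ?_⟩
    · rw [Ne, Fin.mk.injEq]; split_ifs <;> omega
    · ext ⟨w, hw⟩
      simp only [SimpleGraph.mem_neighborFinset, chordedCycle_adj, Finset.mem_insert,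
        Finset.mem_singleton, Fin.mk.injEq]
      dsimp only at h
      split_ifs <;> omega

theorem chordedCycle_card_edgeFinset : (chordedCycle n r hr hn).edgeFinset.card = n + r := by
  have h := (chordedCycle n r hr hn).sum_degrees_eq_twice_card_edges
  have hsum : ∑ v, (chordedCycle n r hr hn).degree v = 2 * n + 2 * r := by
    rw [Finset.sum_congr rfl fun v _ => (chordedCycle_degree hr hn v).trans
      (show _ = 2 + (if v.1 < 2 * r then 1 else 0) by split_ifs <;> rfl)]
    rw [Finset.sum_add_distrib, Fin.sum_univ_eq_sum_range (fun i => if i < 2 * r then 1 else 0) n,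
      ← Finset.card_filter,
      show (Finset.range n).filter (fun i => i < 2 * r) = Finset.range (2 * r) by
        ext i; simp only [Finset.mem_filter, Finset.mem_range]; omega]
    simp [mul_comm]
  omega

theorem mDeg_chordedCycle_le : mDeg (chordedCycle n r hr hn) 2 3 ≤ 2 := by
  unfold mDeg
  refine (Finset.card_le_card (t := {s(⟨2 * r - 1, by omega⟩, ⟨2 * r, by omega⟩),
    s(⟨n - 1, by omega⟩, ⟨0, by omega⟩)}) ?_).trans Finset.card_le_two
  intro e he
  rw [Finset.mem_filter] at he
  induction e with
  | h u v =>
    obtain ⟨huv, hd⟩ := he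
    rw [SimpleGraph.mem_edgeFinset, SimpleGraph.mem_edgeSet, chordedCycle_adj] at huv
    simp only [Sym2.lift_mk, chordedCycle_degree] at hd
    obtain ⟨u, hu⟩ := u
    obtain ⟨v, hv⟩ := v
    simp only [Finset.mem_insert, Finset.mem_singleton, Sym2.eq_iff, Fin.mk.injEq]
    dsimp only at huv hd
    split_ifs at hd <;> omega

end Extremal

theorem minimal_genSombor_kcyclic (α : ℝ) (hα0 : 1 / 2 ≤ α) (hα1 : α < 1)
    (n k : ℕ) (hk : 3 ≤ k) (hn : 5 * (k - 1) ≤ n)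
    (G : SimpleGraph (Fin n)) (hconn : G.Connected) (hm : G.edgeFinset.card = n + k - 1)
    (hmin : ∀ H : SimpleGraph (Fin n), H.Connected → H.edgeFinset.card = n + k - 1 →
      genSomborIndex α G ≤ genSomborIndex α H) :
    (∀ v : Fin n, G.degree v = 2 ∨ G.degree v = 3) ∧
    (∃ v : Fin n, G.degree v = 2) ∧ (∃ v : Fin n, G.degree v = 3) ∧
    mDeg G 2 3 = 2 ∧ mDeg G 2 2 = n - 2 * k + 1 ∧ mDeg G 3 3 = 3 * k - 4 ∧
    genSomborIndex α G
      = 2 * (13 : ℝ) ^ α + ((n : ℝ) - 2 * k + 1) * (8 : ℝ) ^ α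
        + (3 * (k : ℝ) - 4) * (18 : ℝ) ^ α := by
  have hn2 : 2 * (k - 1) + 2 ≤ n := by omega
  have hcardV : Fintype.card (Fin n) = n := Fintype.card_fin n
  have : Nontrivial (Fin n) := Fin.nontrivial_iff_two_le.2 (by omega)
  have hpos : ∀ v, 1 ≤ G.degree v := fun v => hconn.preconnected.degree_pos_of_nontrivial v
  have hk' : ((n + k - 1 : ℕ) : ℝ) = n + k - 1 := by
    rw [Nat.cast_sub (by omega)]; push_cast; ring
  have hs := somborExcess_two_three_pos (by linarith : 0 < α) hα1
  set H := chordedCycle n (k - 1) (by omega) hn2 with hH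
  have hHdeg : ∀ v, H.degree v = 2 ∨ H.degree v = 3 := by
    intro v
    rw [hH, chordedCycle_degree]
    split_ifs <;> simp
  have hHm : H.edgeFinset.card = n + k - 1 := by
    rw [hH, chordedCycle_card_edgeFinset]; omega
  have hGH := hmin H (chordedCycle_connected _ _) (by convert hHm)
  have hGS := genSomborIndex_eq G α hpos
  have hHS := genSomborIndex_eq H α fun v => by rcases hHdeg v with h | h <;> omega
  rw [vdbTI_somborExcess_of_bidegreed H α hHdeg] at hHS
  have hH2 : (mDeg H 2 3 : ℝ) ≤ 2 := by exact_mod_cast mDeg_chordedCycle_le _ hn2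
  have hm' : G.edgeFinset.card = n + k - 1 := by convert hm
  have hex : vdbTI (somborExcess α) G ≤ 2 * somborExcess α 2 3 := by
    rw [hm'] at hGS
    rw [hHm] at hHS
    nlinarith
  have hdeg : ∀ v, G.degree v = 2 ∨ G.degree v = 3 := by
    intro v
    obtain ⟨w, hw⟩ := (G.degree_pos_iff_exists_adj v).1 (hpos v)
    by_contra hv
    have h1 := lt_somborExcess hα0 (hpos v) (hpos w) (fun h => hv h.1)
    have h2 := le_vdbTI_of_adj G (somborExcess_comm α)
      (fun a b _ => somborExcess_nonneg hα0 hα1 (hpos a) (hpos b)) hw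
    linarith
  rw [vdbTI_somborExcess_of_bidegreed G α hdeg] at hex hGS
  have hle : mDeg G 2 3 ≤ 2 := by
    have : (mDeg G 2 3 : ℝ) ≤ 2 := by nlinarith
    exact_mod_cast this
  obtain ⟨n₂, n₃, hn₂₃, h22, h33, hE, hn₂, hn₃⟩ := mDeg_of_bidegreed G hdeg
  rw [hm'] at hE hGS
  obtain ⟨u, hu⟩ := Finset.card_pos.1 (show 0 < (Finset.univ.filter fun v => G.degree v = 2).card by
    omega)
  obtain ⟨v, hv⟩ := Finset.card_pos.1 (show 0 < (Finset.univ.filter fun v => G.degree v = 3).card by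
    omega)
  have hu2 := (Finset.mem_filter.1 hu).2
  have hv3 := (Finset.mem_filter.1 hv).2
  have hpos23 := mDeg_two_three_pos G hconn hdeg hu2 hv3
  have h23 : mDeg G 2 3 = 2 := by omega
  refine ⟨hdeg, ⟨u, hu2⟩, ⟨v, hv3⟩, h23, by omega, by omega, ?_⟩
  rw [hGS, h23, hk', hcardV, somborExcess_two_three]
  push_cast
  ring
end

section
/- Let p > 1 and define φ_p(x,y,z) = (x^p + y^p)^{1/p} − (x^p + (y−z)^p)^{1/p} for x > 0 and y ≥ z > 0. Then φ_p(x,y,z) is strictly decreasing in x. -/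
attribute [local instance] Classical.propDecidable

/-- A strictly concave function has strictly decreasing increments. -/
theorem StrictConcaveOn.add_lt_add_of_pos {s : Set ℝ} {f : ℝ → ℝ} (hf : StrictConcaveOn ℝ s f)
    {u h k : ℝ} (hu : u ∈ s) (hv : u + h + k ∈ s) (hh : 0 < h) (hk : 0 < k) :
    f u + f (u + h + k) < f (u + h) + f (u + k) := by
  have hne : u ≠ u + h + k := by linarith
  have hhk : h + k ≠ 0 := by positivity
  have hsum : h / (h + k) + k / (h + k) = 1 := by field_simp
  have h₁ := hf.2 hu hv hne (by positivity : 0 < k / (h + k)) (by positivity : 0 < h / (h + k))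
    (by rw [add_comm, hsum])
  have h₂ := hf.2 hu hv hne (by positivity : 0 < h / (h + k)) (by positivity : 0 < k / (h + k))
    hsum
  simp only [smul_eq_mul] at h₁ h₂
  have e₁ : k / (h + k) * u + h / (h + k) * (u + h + k) = u + h := by field_simp; ring
  have e₂ : h / (h + k) * u + k / (h + k) * (u + h + k) = u + k := by field_simp; ring
  rw [e₁] at h₁
  rw [e₂] at h₂
  linear_combination h₁ + h₂ - (f u + f (u + h + k)) * hsum

theorem pSombor_phi_strictAnti (p : ℝ) (hp : 1 < p)
    (y z : ℝ) (hz : 0 < z) (hzy : z ≤ y) :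
    StrictAntiOn (fun x : ℝ => (x ^ p + y ^ p) ^ (1 / p) - (x ^ p + (y - z) ^ p) ^ (1 / p))
      (Set.Ioi 0) := by
  intro a ha b _ hab
  have hp₀ : 0 < p := by linarith
  have ha₀ : 0 < a := ha
  have hyz : 0 ≤ y - z := by linarith
  have hxx : a ^ p < b ^ p := Real.rpow_lt_rpow ha₀.le hab hp₀
  have hyy : (y - z) ^ p < y ^ p := Real.rpow_lt_rpow hyz (by linarith) hp₀
  have hu : 0 ≤ a ^ p + (y - z) ^ p := by positivity
  have key := (Real.strictConcaveOn_rpow (one_div_pos.2 hp₀)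
    ((div_lt_one hp₀).2 hp)).add_lt_add_of_pos (u := a ^ p + (y - z) ^ p)
    (h := b ^ p - a ^ p) (k := y ^ p - (y - z) ^ p) (Set.mem_Ici.2 hu)
    (Set.mem_Ici.2 (by linarith)) (sub_pos.2 hxx) (sub_pos.2 hyy)
  have e₁ : a ^ p + (y - z) ^ p + (b ^ p - a ^ p) + (y ^ p - (y - z) ^ p) = b ^ p + y ^ p := by
    ring
  have e₂ : a ^ p + (y - z) ^ p + (b ^ p - a ^ p) = b ^ p + (y - z) ^ p := by ring
  have e₃ : a ^ p + (y - z) ^ p + (y ^ p - (y - z) ^ p) = a ^ p + y ^ p := by ring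
  rw [e₁, e₂, e₃] at key
  dsimp only
  linarith
end

section
/- Let p ∈ (1, 2] and let a, b be real numbers with a > b + 1 ≥ 2. Then a·[(2a^p)^{1/p} − ((a−1)^p + a^p)^{1/p}] − b·[((b+1)^p + b^p)^{1/p} − (2b^p)^{1/p}] > 0. In particular, the function I(x,y) = (x^p + y^p)^{1/p} satisfies H(a,b) > 0 for all a > b + 1 ≥ 2, where H(a,b) = a[I(a,a) − I(a−1,a)] − b[I(b+1,b) − I(b,b)]. -/
attribute [local instance] Classical.propDecidable

theorem two_mul_rpow_rpow_one_div {p x : ℝ} (hp : p ≠ 0) (hx : 0 ≤ x) :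
    (2 * x ^ p) ^ (1 / p) = 2 ^ (1 / p) * x := by
  rw [Real.mul_rpow zero_le_two (Real.rpow_nonneg hx p), one_div, Real.rpow_rpow_inv hx hp]

theorem rpow_add_rpow_translate_le {p x y t : ℝ} (hp : 1 ≤ p) (hx : 0 ≤ x) (hy : 0 ≤ y)
    (ht : 0 ≤ t) :
    ((x + t) ^ p + (y + t) ^ p) ^ (1 / p) ≤ (x ^ p + y ^ p) ^ (1 / p) + 2 ^ (1 / p) * t := by
  have h := Real.Lp_add_le_of_nonneg (s := Finset.univ) (f := ![x, y]) (g := ![t, t]) hp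
    (by simp [Fin.forall_fin_two, hx, hy]) (by simp [Fin.forall_fin_two, ht])
  simp only [Fin.sum_univ_two, Matrix.cons_val_zero, Matrix.cons_val_one] at h
  rwa [← two_mul (t ^ p), two_mul_rpow_rpow_one_div (by linarith) ht] at h

/-- The power mean of exponent `p ≤ 2` is at most the quadratic mean, which is strictly below the
contraharmonic mean. -/
theorem add_mul_rpow_add_rpow_lt {p x y : ℝ} (hp0 : 0 < p) (hp : p ≤ 2) (hx : 0 < x) (hy : 0 < y)
    (hxy : x ≠ y) :
    (x + y) * (x ^ p + y ^ p) ^ (1 / p) < 2 ^ (1 / p) * (x ^ 2 + y ^ 2) := by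
  have hxp := Real.rpow_pos_of_pos hx p
  have hyp := Real.rpow_pos_of_pos hy p
  set m := ((x ^ p + y ^ p) / 2) ^ (1 / p) with hm
  have hm0 : 0 < m := by positivity
  have hI : (x ^ p + y ^ p) ^ (1 / p) = 2 ^ (1 / p) * m := by
    rw [hm, ← Real.mul_rpow zero_le_two (by positivity)]
    congr 1
    ring
  have hpow : ∀ z : ℝ, 0 ≤ z → (z ^ p) ^ (2 / p) = z ^ 2 := fun z hz => by
    rw [← Real.rpow_mul hz, mul_div_cancel₀ _ hp0.ne', Real.rpow_two]
  have hm2 : m ^ 2 ≤ (x ^ 2 + y ^ 2) / 2 := by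
    have h := (convexOn_rpow ((one_le_div hp0).2 hp)).2 hxp.le hyp.le
      (one_half_pos (α := ℝ)).le one_half_pos.le (add_halves 1)
    simp only [smul_eq_mul] at h
    rw [hpow x hx.le, hpow y hy.le] at h
    have hmeq : m ^ 2 = (1 / 2 * x ^ p + 1 / 2 * y ^ p) ^ (2 / p) := by
      rw [hm, ← Real.rpow_two, ← Real.rpow_mul (by positivity)]
      congr 1 <;> ring
    linarith
  have hlt : (x + y) * m < x ^ 2 + y ^ 2 := by
    refine lt_of_pow_lt_pow_left₀ 2 (by positivity) ?_
    have hd : 0 < (x - y) ^ 2 := by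
      have := sub_ne_zero.2 hxy
      positivity
    have hs : 0 < x ^ 2 + y ^ 2 := by positivity
    calc ((x + y) * m) ^ 2 = (x + y) ^ 2 * m ^ 2 := by ring
      _ ≤ (x + y) ^ 2 * ((x ^ 2 + y ^ 2) / 2) := by gcongr
      _ < (x ^ 2 + y ^ 2) ^ 2 := by nlinarith [mul_pos hd hs]
  calc (x + y) * (x ^ p + y ^ p) ^ (1 / p) = 2 ^ (1 / p) * ((x + y) * m) := by rw [hI]; ring
    _ < 2 ^ (1 / p) * (x ^ 2 + y ^ 2) := by gcongr

theorem pSombor_H_pos (p : ℝ) (hp0 : 1 < p) (hp1 : p ≤ 2)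
    (a b : ℝ) (hb : 2 ≤ b + 1) (hab : b + 1 < a) :
    0 < a * ((2 * a ^ p) ^ (1 / p) - ((a - 1) ^ p + a ^ p) ^ (1 / p))
      - b * (((b + 1) ^ p + b ^ p) ^ (1 / p) - (2 * b ^ p) ^ (1 / p)) := by
  have hb0 : 0 < b := by linarith
  have hb1 : 0 < b + 1 := by linarith
  have hp : 0 < p := by linarith
  have hmean := add_mul_rpow_add_rpow_lt hp hp1 hb0 hb1 (by linarith)
  have htrans := rpow_add_rpow_translate_le hp0.le hb0.le hb1.le (sub_nonneg.2 hab.le)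
  rw [show b + (a - (b + 1)) = a - 1 by ring, show b + 1 + (a - (b + 1)) = a by ring] at htrans
  rw [two_mul_rpow_rpow_one_div hp.ne' (by linarith), two_mul_rpow_rpow_one_div hp.ne' hb0.le,
    add_comm ((b + 1) ^ p)]
  have hmono : (b ^ p + (b + 1) ^ p) ^ (1 / p) ≤ 2 ^ (1 / p) * (b + 1) := by
    rw [← two_mul_rpow_rpow_one_div hp.ne' hb1.le, two_mul]
    gcongr
    linarith
  set c : ℝ := 2 ^ (1 / p)
  set I := (b ^ p + (b + 1) ^ p) ^ (1 / p)
  set J := ((a - 1) ^ p + a ^ p) ^ (1 / p)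
  have hstep : (b + 1) * (c * (b + 1) - I) ≤ a * (c * a - J) :=
    mul_le_mul hab.le (by linarith) (by linarith) (by linarith)
  linarith
end

section
/- Let α ∈ (0,1) and let a, b be real numbers with a > b + 1 ≥ 2. Then a·[(2a)^α − (2a−1)^α] − b·[(2b+1)^α − (2b)^α] > 0. In particular, the function I(x,y) = (x + y)^α satisfies H(a,b) > 0 for all a > b + 1 ≥ 2, where H(a,b) = a[I(a,a) − I(a−1,a)] − b[I(b+1,b) − I(b,b)]. -/
/-- The tangent-line bound for the concave function `x ↦ x ^ α`, multiplied by `x`. -/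
theorem mul_rpow_add_sub_rpow_le {α x h : ℝ} (hα0 : 0 ≤ α) (hα1 : α ≤ 1) (hx : 0 < x)
    (hh : -x ≤ h) : x * ((x + h) ^ α - x ^ α) ≤ α * h * x ^ α := by
  have hs : -1 ≤ h / x := by rw [le_div_iff₀ hx]; linarith
  have bernoulli := rpow_one_add_le_one_add_mul_self hs hα0 hα1
  have hfac : (x + h) ^ α = x ^ α * (1 + h / x) ^ α := by
    rw [← Real.mul_rpow hx.le (by linarith)]
    congr 1
    field_simp
  calc x * ((x + h) ^ α - x ^ α) = x * (x ^ α * ((1 + h / x) ^ α - 1)) := by rw [hfac]; ring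
    _ ≤ x * (x ^ α * (α * (h / x))) := by gcongr; linarith
    _ = α * h * x ^ α := by field_simp

theorem genSumConn_H_pos (α : ℝ) (hα0 : 0 < α) (hα1 : α < 1)
    (a b : ℝ) (hb : 2 ≤ b + 1) (hab : b + 1 < a) :
    0 < a * ((2 * a) ^ α - (2 * a - 1) ^ α) - b * ((2 * b + 1) ^ α - (2 * b) ^ α) := by
  have ha := mul_rpow_add_sub_rpow_le (x := 2 * a) (h := -1) hα0.le hα1.le
    (by linarith) (by linarith)
  have hb' := mul_rpow_add_sub_rpow_le (x := 2 * b) (h := 1) hα0.le hα1.le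
    (by linarith) (by linarith)
  have hlt : α * (2 * b) ^ α < α * (2 * a) ^ α :=
    mul_lt_mul_of_pos_left (Real.rpow_lt_rpow (by linarith) (by linarith) hα0) hα0
  rw [← sub_eq_add_neg] at ha
  linarith
end
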